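/- Let 𝔪 ⊆ S be the ideal generated by all the variables (the maximal homogeneous ideal). Then the top nonvanishing local cohomology module H^{n·(m−n)+1}_I(S) is isomorphic as an S-module to H^{m·n}_𝔪(S) (which is the injective hull of the residue field K over S). -/

import Mathlib

section LocalCohomology

open CategoryTheory CategoryTheory.Limits CategoryTheory.Abelian

section LinearEquivOfKernels
variable {R A B C : Type*} [Ring R] [AddCommGroup A] [AddCommGroup B] [AddCommGroup C]
  [Module R A] [Module R B] [Module R C]

/-- Two quotients of a module by the same submodule are linearly equivalent. -/
noncomputable def LinearEquiv.ofKerEq (p : A →ₗ[R] B) (q : A →ₗ[R] C)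
    (hp : Function.Surjective p) (hq : Function.Surjective q)
    (h : LinearMap.ker p = LinearMap.ker q) : B ≃ₗ[R] C :=
  (p.quotKerEquivOfSurjective hp).symm ≪≫ₗ Submodule.quotEquivOfEq _ _ h ≪≫ₗ
    q.quotKerEquivOfSurjective hq

theorem LinearEquiv.ofKerEq_apply (p : A →ₗ[R] B) (q : A →ₗ[R] C)
    (hp : Function.Surjective p) (hq : Function.Surjective q)
    (h : LinearMap.ker p = LinearMap.ker q) (a : A) :
    LinearEquiv.ofKerEq p q hp hq h (p a) = q a := by
  have : (p.quotKerEquivOfSurjective hp).symm (p a) = Submodule.Quotient.mk a := by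
    rw [LinearEquiv.symm_apply_eq]; rfl
  simp only [LinearEquiv.ofKerEq, LinearEquiv.trans_apply, this]
  rfl
end LinearEquivOfKernels

section CohomologyClass
variable {R : Type*} [Ring R] (K : CochainComplex (ModuleCat.{0} R) ℕ) (n : ℕ)

/-- The cohomology class of a cocycle. -/
noncomputable def cohomologyClass :
    LinearMap.ker (K.d n (n + 1)).hom →ₗ[R] K.homology n :=
  (K.liftCycles (ModuleCat.ofHom (LinearMap.ker (K.d n (n + 1)).hom).subtype) (n + 1)
    (by simp) (by ext x; exact x.2) ≫ K.homologyπ n).hom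

theorem cohomologyClass_surjective : Function.Surjective (cohomologyClass K n) := by
  intro y
  obtain ⟨z, rfl⟩ := (ModuleCat.epi_iff_surjective (K.homologyπ n)).1 inferInstance y
  refine ⟨⟨K.iCycles n z, ?_⟩, ?_⟩
  · rw [LinearMap.mem_ker]
    exact congr($(K.iCycles_d n (n+1)) z)
  · rw [cohomologyClass, ModuleCat.comp_apply]
    congr 1
    apply (ModuleCat.mono_iff_injective (K.iCycles n)).1 inferInstance
    have := K.liftCycles_i (ModuleCat.ofHom (LinearMap.ker (K.d n (n + 1)).hom).subtype) (n + 1)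
      (by simp) (by ext x; exact x.2)
    have hz : K.d n (n + 1) (K.iCycles n z) = 0 := congr($(K.iCycles_d n (n+1)) z)
    exact congr($this ⟨K.iCycles n z, hz⟩)

theorem cohomologyClass_eq_zero_iff {m : ℕ} (hm : m + 1 = n)
    (z : LinearMap.ker (K.d n (n + 1)).hom) :
    cohomologyClass K n z = 0 ↔ ∃ y, K.d m n y = z.1 := by
  have hl := K.liftCycles_i (ModuleCat.ofHom (LinearMap.ker (K.d n (n + 1)).hom).subtype) (n + 1)
      (by simp) (by ext x; exact x.2)
  have hinj := (ModuleCat.mono_iff_injective (K.iCycles n)).1 inferInstance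
  have hex : (ShortComplex.mk (K.toCycles m n) (K.homologyπ n) (by simp)).Exact :=
    ShortComplex.exact_of_g_is_cokernel _ (K.homologyIsCokernel m n (by simp [← hm]))
  rw [ShortComplex.moduleCat_exact_iff] at hex
  rw [cohomologyClass, ModuleCat.comp_apply]
  constructor
  · intro h
    obtain ⟨y, hy⟩ := hex _ h
    refine ⟨y, ?_⟩
    have h1 : K.iCycles n (K.toCycles m n y) = K.d m n y := congr($(K.toCycles_i m n) y)
    rw [← h1]
    refine (congr_arg (K.iCycles n) hy).trans ?_
    exact congr($hl z)
  · rintro ⟨y, hy⟩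
    have h1 : K.iCycles n (K.toCycles m n y) = K.d m n y := congr($(K.toCycles_i m n) y)
    have h2 : K.toCycles m n y = K.liftCycles (ModuleCat.ofHom (LinearMap.ker (K.d n (n + 1)).hom).subtype) (n + 1)
      (by simp) (by ext x; exact x.2) z := by
      apply hinj
      rw [h1, hy]
      exact (congr($hl z)).symm
    have h3 : K.homologyπ n (K.toCycles m n y) = 0 := congr($(K.toCycles_comp_homologyπ m n) y)
    refine (congr_arg (K.homologyπ n) h2).symm.trans h3

theorem homologyMap_cohomologyClass {K L : CochainComplex (ModuleCat.{0} R) ℕ} (φ : K ⟶ L) (n : ℕ)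
    (z : LinearMap.ker (K.d n (n + 1)).hom) (w : LinearMap.ker (L.d n (n + 1)).hom)
    (h : w.1 = φ.f n z.1) :
    HomologicalComplex.homologyMap φ n (cohomologyClass K n z) = cohomologyClass L n w := by
  rw [cohomologyClass, cohomologyClass, ModuleCat.comp_apply, ModuleCat.comp_apply]
  have h1 (t) : HomologicalComplex.homologyMap φ n (K.homologyπ n t) =
      L.homologyπ n (HomologicalComplex.cyclesMap φ n t) :=
    congr($(HomologicalComplex.homologyπ_naturality φ n) t)
  refine (h1 _).trans ?_
  congr 1
  have hinj := (ModuleCat.mono_iff_injective (L.iCycles n)).1 inferInstance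
  apply hinj
  have h2 (t) : L.iCycles n (HomologicalComplex.cyclesMap φ n t) = φ.f n (K.iCycles n t) :=
    congr($(HomologicalComplex.cyclesMap_i φ n) t)
  refine (h2 _).trans ?_
  have hK := K.liftCycles_i (ModuleCat.ofHom (LinearMap.ker (K.d n (n + 1)).hom).subtype) (n + 1)
      (by simp) (by ext x; exact x.2)
  have hL := L.liftCycles_i (ModuleCat.ofHom (LinearMap.ker (L.d n (n + 1)).hom).subtype) (n + 1)
      (by simp) (by ext x; exact x.2)
  have hL' := congr($hL w)
  have hK' := congr($hK z)
  refine (congr_arg (φ.f n) hK').trans ?_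
  exact h.symm.trans hL'.symm
end CohomologyClass

section OldExt
variable {S : Type} [CommRing S]

/-- The class in `Ext S (ModuleCat S) n` of a cocycle on a projective resolution. -/
noncomputable def oldExtClass {X : ModuleCat.{0} S} (P : ProjectiveResolution X) (Y : ModuleCat.{0} S)
    (n : ℕ) :
    LinearMap.ker ((P.complex.linearYonedaObj S Y).d n (n + 1)).hom →ₗ[S]
      ((Ext S (ModuleCat.{0} S) n).obj (Opposite.op X)).obj Y :=
  (P.isoExt (R := S) n Y).inv.hom ∘ₗ cohomologyClass _ n

theorem oldExtClass_surjective {X : ModuleCat.{0} S} (P : ProjectiveResolution X)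
    (Y : ModuleCat.{0} S) (n : ℕ) : Function.Surjective (oldExtClass P Y n) := by
  rw [oldExtClass, LinearMap.coe_comp]
  exact ((ModuleCat.epi_iff_surjective (P.isoExt (R := S) n Y).inv).1 inferInstance).comp
    (cohomologyClass_surjective _ _)

theorem oldExtClass_eq_zero_iff {X : ModuleCat.{0} S} (P : ProjectiveResolution X)
    (Y : ModuleCat.{0} S) (n m : ℕ) (hm : m + 1 = n)
    (z : LinearMap.ker ((P.complex.linearYonedaObj S Y).d n (n + 1)).hom) :
    oldExtClass P Y n z = 0 ↔
      ∃ y : P.complex.X m ⟶ Y, P.complex.d n m ≫ y = z.1 := by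
  have hinj := (ModuleCat.mono_iff_injective (P.isoExt (R := S) n Y).inv).1 inferInstance
  rw [oldExtClass, LinearMap.comp_apply]
  refine (map_eq_zero_iff (P.isoExt (R := S) n Y).inv.hom hinj).trans ?_
  exact cohomologyClass_eq_zero_iff _ n hm z

theorem map_oldExtClass {X X' : ModuleCat.{0} S} (P : ProjectiveResolution X)
    (P' : ProjectiveResolution X') (g : X ⟶ X') (φ : ProjectiveResolution.Hom P P' g)
    (Y : ModuleCat.{0} S) (n : ℕ)
    (z : LinearMap.ker ((P'.complex.linearYonedaObj S Y).d n (n + 1)).hom)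
    (w : LinearMap.ker ((P.complex.linearYonedaObj S Y).d n (n + 1)).hom)
    (h : w.1 = φ.hom.f n ≫ (z.1 : P'.complex.X n ⟶ Y)) :
    ((Ext S (ModuleCat.{0} S) n).map g.op).app Y (oldExtClass P' Y n z) = oldExtClass P Y n w := by
  let F := ((linearYoneda S (ModuleCat.{0} S)).obj Y).rightOp
  let Φ := (F.mapHomologicalComplex (ComplexShape.down ℕ)).map φ.hom
  have hnat := ProjectiveResolution.isoLeftDerivedObj_hom_naturality g P P' φ.hom
    φ.hom_f_zero_comp_π_f_zero F n
  let Ψ : P'.complex.linearYonedaObj S Y ⟶ P.complex.linearYonedaObj S Y :=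
    (HomologicalComplex.unopFunctor _ _).map Φ.op
  have h2 : HomologicalComplex.homologyMap Ψ n ≫ (HomologicalComplex.homologyUnop _ n).hom =
      (HomologicalComplex.homologyUnop _ n).hom ≫ (HomologicalComplex.homologyMap Φ n).unop := by
    have := HomologicalComplex.homologyOp_hom_naturality Ψ n
    exact congr_arg Quiver.Hom.unop this.symm
  have h3 : (P'.isoExt (R := S) n Y).inv ≫ ((Ext S (ModuleCat.{0} S) n).map g.op).app Y =
      HomologicalComplex.homologyMap Ψ n ≫ (P.isoExt (R := S) n Y).inv := by
    have e1 : (P'.isoExt (R := S) n Y).inv ≫ ((Ext S (ModuleCat.{0} S) n).map g.op).app Y =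
      (HomologicalComplex.homologyUnop _ n).hom ≫ ((F.leftDerived n).map g ≫
        (P'.isoLeftDerivedObj F n).hom).unop := rfl
    have e2 : HomologicalComplex.homologyMap Ψ n ≫ (P.isoExt (R := S) n Y).inv =
      (HomologicalComplex.homologyMap Ψ n ≫ (HomologicalComplex.homologyUnop _ n).hom) ≫
        (P.isoLeftDerivedObj F n).hom.unop := rfl
    rw [e1, e2, h2, hnat]
    rfl
  have h4 := congr($h3 (cohomologyClass _ n z))
  refine h4.trans ?_
  exact congr_arg (P.isoExt (R := S) n Y).inv (homologyMap_cohomologyClass Ψ n z w h)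
end OldExt

section NewExt
variable {S : Type} [CommRing S]

theorem projExtMk_smul {X Y : ModuleCat.{0} S} (P : ProjectiveResolution X) (n : ℕ) (s : S)
    (f : P.complex.X n ⟶ Y) (hf : P.complex.d (n + 1) n ≫ f = 0)
    (hf' : P.complex.d (n + 1) n ≫ (s • f) = 0) :
    P.extMk (s • f) (n + 1) rfl hf' = s • (P.extMk f (n + 1) rfl hf : Abelian.Ext.{0} X Y n) := by
  rw [Abelian.Ext.smul_eq_comp_mk₀, ProjectiveResolution.extMk_comp_mk₀]
  congr 1

theorem projResolutionHom_comp_cocycle {X X' Y : ModuleCat.{0} S} {P : ProjectiveResolution X}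
    {P' : ProjectiveResolution X'} {g : X ⟶ X'} (φ : ProjectiveResolution.Hom P P' g) (n : ℕ)
    (f : P'.complex.X n ⟶ Y) (hf : P'.complex.d (n + 1) n ≫ f = 0) :
    P.complex.d (n + 1) n ≫ φ.hom.f n ≫ f = 0 := by
  rw [← φ.hom.comm_assoc, hf, comp_zero]

/-- The class in `Abelian.Ext` of a cocycle on a projective resolution. -/
noncomputable def projExtClass {X : ModuleCat.{0} S} (P : ProjectiveResolution X) (Y : ModuleCat.{0} S)
    (n : ℕ) :
    LinearMap.ker ((P.complex.linearYonedaObj S Y).d n (n + 1)).hom →ₗ[S] Abelian.Ext.{0} X Y n where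
  toFun z := P.extMk (z.1 : P.complex.X n ⟶ Y) (n + 1) rfl z.2
  map_add' z w := (P.add_extMk _ _ _ _ _ _).symm
  map_smul' s z := by
    exact projExtMk_smul P n s _ z.2 _

theorem projExtClass_surjective {X : ModuleCat.{0} S} (P : ProjectiveResolution X)
    (Y : ModuleCat.{0} S) (n : ℕ) : Function.Surjective (projExtClass P Y n) := by
  intro α
  obtain ⟨f, hf, rfl⟩ := P.extMk_surjective α (n + 1) rfl
  exact ⟨⟨f, hf⟩, rfl⟩

theorem projExtClass_eq_zero_iff {X : ModuleCat.{0} S} (P : ProjectiveResolution X)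
    (Y : ModuleCat.{0} S) (n m : ℕ) (hm : m + 1 = n)
    (z : LinearMap.ker ((P.complex.linearYonedaObj S Y).d n (n + 1)).hom) :
    projExtClass P Y n z = 0 ↔
      ∃ y : P.complex.X m ⟶ Y, P.complex.d n m ≫ y = z.1 :=
  P.extMk_eq_zero_iff (z.1 : P.complex.X n ⟶ Y) (n + 1) rfl z.2 m hm

/-- The comparison between the derived functor `Ext` and `Abelian.Ext`. -/
noncomputable def extComparison (X Y : ModuleCat.{0} S) (n m : ℕ) (hm : m + 1 = n) :
    ((Ext S (ModuleCat.{0} S) n).obj (Opposite.op X)).obj Y ≃ₗ[S] Abelian.Ext.{0} X Y n :=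
  LinearEquiv.ofKerEq (oldExtClass (ProjectiveResolution.of X) Y n)
    (projExtClass (ProjectiveResolution.of X) Y n) (oldExtClass_surjective _ _ _)
    (projExtClass_surjective _ _ _)
    (by
      ext z
      rw [LinearMap.mem_ker, LinearMap.mem_ker, oldExtClass_eq_zero_iff _ _ _ _ hm,
        projExtClass_eq_zero_iff _ _ _ _ hm])

theorem extComparison_map {X X' : ModuleCat.{0} S} (g : X ⟶ X') (Y : ModuleCat.{0} S)
    (n m : ℕ) (hm : m + 1 = n)
    (x : ((Ext S (ModuleCat.{0} S) n).obj (Opposite.op X')).obj Y) :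
    extComparison X Y n m hm (((Ext S (ModuleCat.{0} S) n).map g.op).app Y x) =
      (Abelian.Ext.mk₀ g).comp (extComparison X' Y n m hm x) (zero_add n) := by
  obtain ⟨z, rfl⟩ := oldExtClass_surjective (ProjectiveResolution.of X') Y n x
  let φ : ProjectiveResolution.Hom (ProjectiveResolution.of X) (ProjectiveResolution.of X') g :=
    { hom := ProjectiveResolution.lift g _ _
      hom_f_zero_comp_π_f_zero := by
        rw [ProjectiveResolution.lift_commutes_zero]; simp }
  have hz : (ProjectiveResolution.of X').complex.d (n + 1) n ≫
    (z.1 : (ProjectiveResolution.of X').complex.X n ⟶ Y) = 0 := z.2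
  let w : LinearMap.ker (((ProjectiveResolution.of X).complex.linearYonedaObj S Y).d n (n + 1)).hom :=
    ⟨φ.hom.f n ≫ (z.1 : (ProjectiveResolution.of X').complex.X n ⟶ Y),
      projResolutionHom_comp_cocycle φ n z.1 z.2⟩
  rw [map_oldExtClass (ProjectiveResolution.of X) (ProjectiveResolution.of X') g φ Y n z w rfl,
    extComparison, LinearEquiv.ofKerEq_apply]
  rw [extComparison, LinearEquiv.ofKerEq_apply]
  exact (ProjectiveResolution.mk₀_comp_extMk (R := ProjectiveResolution.of X')
    (R' := ProjectiveResolution.of X) (Y := Y) (n := n) z.1 (n + 1) rfl hz φ).symm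

/-- The class in `Abelian.Ext` of a cocycle in an injective resolution. -/
noncomputable def injExtClass {Y : ModuleCat.{0} S} (I : InjectiveResolution Y) (X : ModuleCat.{0} S)
    (n : ℕ) (f : X ⟶ I.cocomplex.X n) (hf : f ≫ I.cocomplex.d n (n + 1) = 0) :
    Abelian.Ext.{0} X Y n := I.extMk f (n + 1) rfl hf

theorem injExtClass_smul {Y : ModuleCat.{0} S} (I : InjectiveResolution Y) (X : ModuleCat.{0} S)
    (n : ℕ) (s : S) (f : X ⟶ I.cocomplex.X n) (hf : f ≫ I.cocomplex.d n (n + 1) = 0) :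
    injExtClass I X n (s • f) (by rw [Linear.smul_comp, hf, smul_zero]) =
      s • injExtClass I X n f hf := by
  have := I.mk₀_comp_extMk f (n + 1) rfl hf (s • 𝟙 X)
  rw [Abelian.Ext.mk₀_smul, Abelian.Ext.smul_comp, Abelian.Ext.mk₀_id_comp] at this
  rw [injExtClass, injExtClass, this]
  congr 1
  rw [Linear.smul_comp, Category.id_comp]
end NewExt

section LocalCohomologyInjective
variable {S : Type} [CommRing S]

/-- The submodule of elements killed by a power of the ideal `J`. -/
def powTorsion (J : Ideal S) (M : Type*) [AddCommGroup M] [Module S M] : Submodule S M where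
  carrier := {x | ∃ t : ℕ, ∀ a ∈ J ^ t, a • x = 0}
  zero_mem' := ⟨0, fun a _ => smul_zero a⟩
  add_mem' := by
    rintro x y ⟨s, hs⟩ ⟨t, ht⟩
    refine ⟨s + t, fun a ha => ?_⟩
    rw [smul_add, hs a (Ideal.pow_le_pow_right (Nat.le_add_right s t) ha),
      ht a (Ideal.pow_le_pow_right (Nat.le_add_left t s) ha), add_zero]
  smul_mem' := by
    rintro c x ⟨s, hs⟩
    exact ⟨s, fun a ha => by rw [smul_comm, hs a ha, smul_zero]⟩

theorem mem_powTorsion {J : Ideal S} {M : Type*} [AddCommGroup M] [Module S M] {x : M} :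
    x ∈ powTorsion J M ↔ ∃ t : ℕ, ∀ a ∈ J ^ t, a • x = 0 := Iff.rfl

/-- The map `S ⧸ J → M` sending `1` to an element killed by `J`. -/
noncomputable def quotientHom (J : Ideal S) {M : ModuleCat.{0} S} (z : M) (hz : ∀ a ∈ J, a • z = 0) :
    ModuleCat.of S (S ⧸ J) ⟶ M :=
  ModuleCat.ofHom (Submodule.liftQ J (LinearMap.toSpanSingleton S M z) hz)

theorem quotientHom_mk (J : Ideal S) {M : ModuleCat.{0} S} (z : M) (hz : ∀ a ∈ J, a • z = 0) (s : S) :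
    quotientHom J z hz (Submodule.Quotient.mk s) = s • z := rfl

theorem quotientHom_ext {J : Ideal S} {M : ModuleCat.{0} S} {f g : ModuleCat.of S (S ⧸ J) ⟶ M}
    (h : f (Submodule.Quotient.mk (1 : S)) = g (Submodule.Quotient.mk (1 : S))) : f = g := by
  refine ModuleCat.hom_ext (LinearMap.ext fun x => ?_)
  obtain ⟨s, rfl⟩ := Submodule.Quotient.mk_surjective _ x
  have hs : (Submodule.Quotient.mk s : S ⧸ J) = s • Submodule.Quotient.mk (1 : S) := by
    rw [← Submodule.Quotient.mk_smul, smul_eq_mul, mul_one]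
  rw [hs]
  exact (map_smul f.hom _ _).trans ((congr_arg (s • ·) h).trans (map_smul g.hom _ _).symm)

theorem quotientHom_comp {J : Ideal S} {M N : ModuleCat.{0} S} (z : M) (hz : ∀ a ∈ J, a • z = 0)
    (d : M ⟶ N) (hd : d z = 0) : quotientHom J z hz ≫ d = 0 := by
  apply quotientHom_ext
  rw [ModuleCat.comp_apply, quotientHom_mk, one_smul, hd]
  rfl

variable {Y : ModuleCat.{0} S} (I : InjectiveResolution Y)

/-- The class in `Ext (S ⧸ J) Y` of a cocycle killed by `J`. -/
noncomputable def quotientExtClass (n : ℕ) (J : Ideal S) :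
    (LinearMap.ker (I.cocomplex.d n (n + 1)).hom ⊓ Submodule.torsionBySet S (I.cocomplex.X n) J :
      Submodule S (I.cocomplex.X n)) →ₗ[S] Abelian.Ext.{0} (ModuleCat.of S (S ⧸ J)) Y n where
  toFun z := injExtClass I _ n
    (quotientHom J z.1 fun a ha => (Submodule.mem_torsionBySet_iff _ _).1 z.2.2 ⟨a, ha⟩)
    (quotientHom_comp _ _ _ z.2.1)
  map_add' z w := by
    rw [injExtClass, injExtClass, injExtClass, InjectiveResolution.add_extMk]
    congr 1
    apply quotientHom_ext
    change (1 : S) • (z.1 + w.1) = (1 : S) • z.1 + (1 : S) • w.1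
    rw [smul_add]
  map_smul' s z := by
    rw [RingHom.id_apply, ← injExtClass_smul]
    congr 1
    apply quotientHom_ext
    change (1 : S) • (s • z.1) = s • ((1 : S) • z.1)
    rw [one_smul, one_smul]

theorem quotientExtClass_apply (n : ℕ) (J : Ideal S)
    (z : (LinearMap.ker (I.cocomplex.d n (n + 1)).hom ⊓
      Submodule.torsionBySet S (I.cocomplex.X n) J : Submodule S (I.cocomplex.X n))) :
    quotientExtClass I n J z = injExtClass I _ n
      (quotientHom J z.1 fun a ha => (Submodule.mem_torsionBySet_iff _ _).1 z.2.2 ⟨a, ha⟩)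
      (quotientHom_comp _ _ _ z.2.1) := rfl

theorem quotientExtClass_surjective (n : ℕ) (J : Ideal S) :
    Function.Surjective (quotientExtClass I n J) := by
  intro α
  obtain ⟨f, hf, rfl⟩ := I.extMk_surjective α (n + 1) rfl
  refine ⟨⟨f (Submodule.Quotient.mk (1 : S)), ?_, ?_⟩, ?_⟩
  · exact congr($hf (Submodule.Quotient.mk (1 : S)))
  · refine (Submodule.mem_torsionBySet_iff _ _).2 fun a => ?_
    refine (map_smul f.hom _ _).symm.trans ?_
    have : (a : S) • (Submodule.Quotient.mk (1 : S) : S ⧸ J) = 0 := by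
      rw [← Submodule.Quotient.mk_smul, smul_eq_mul, mul_one, Submodule.Quotient.mk_eq_zero]
      exact a.2
    rw [this]
    exact map_zero f.hom
  · rw [quotientExtClass_apply, injExtClass]
    congr 1
    apply quotientHom_ext
    rw [quotientHom_mk, one_smul]

theorem quotientExtClass_eq_zero_iff {n m : ℕ} (hm : m + 1 = n) (J : Ideal S)
    (z : (LinearMap.ker (I.cocomplex.d n (n + 1)).hom ⊓
      Submodule.torsionBySet S (I.cocomplex.X n) J : Submodule S (I.cocomplex.X n))) :
    quotientExtClass I n J z = 0 ↔
      ∃ y : I.cocomplex.X m, (∀ a ∈ J, a • y = 0) ∧ I.cocomplex.d m n y = z.1 := by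
  rw [quotientExtClass_apply, injExtClass]
  refine (I.extMk_eq_zero_iff _ (n + 1) rfl (quotientHom_comp _ _ _ z.2.1) m hm).trans ⟨?_, ?_⟩
  · rintro ⟨g, hg⟩
    refine ⟨g (Submodule.Quotient.mk (1 : S)), fun a ha => ?_, ?_⟩
    · refine (map_smul g.hom _ _).symm.trans ?_
      have : a • (Submodule.Quotient.mk (1 : S) : S ⧸ J) = 0 := by
        rw [← Submodule.Quotient.mk_smul, smul_eq_mul, mul_one, Submodule.Quotient.mk_eq_zero]
        exact ha
      rw [this]
      exact map_zero g.hom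
    · exact congr($hg (Submodule.Quotient.mk (1 : S))).trans (one_smul S z.1)
  · rintro ⟨y, hy, hyz⟩
    refine ⟨quotientHom J y hy, quotientHom_ext ?_⟩
    rw [ModuleCat.comp_apply, quotientHom_mk, quotientHom_mk, one_smul, one_smul, hyz]

theorem mk₀_comp_quotientExtClass (n : ℕ) {J J' : Ideal S}
    (g : ModuleCat.of S (S ⧸ J') ⟶ ModuleCat.of S (S ⧸ J))
    (hg : g (Submodule.Quotient.mk (1 : S)) = Submodule.Quotient.mk (1 : S))
    (z : (LinearMap.ker (I.cocomplex.d n (n + 1)).hom ⊓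
      Submodule.torsionBySet S (I.cocomplex.X n) J : Submodule S (I.cocomplex.X n)))
    (z' : (LinearMap.ker (I.cocomplex.d n (n + 1)).hom ⊓
      Submodule.torsionBySet S (I.cocomplex.X n) J' : Submodule S (I.cocomplex.X n)))
    (hz : z.1 = z'.1) :
    (Abelian.Ext.mk₀ g).comp (quotientExtClass I n J z) (zero_add n) =
      quotientExtClass I n J' z' := by
  rw [quotientExtClass_apply, quotientExtClass_apply, injExtClass, injExtClass]
  refine (I.mk₀_comp_extMk _ (n + 1) rfl (quotientHom_comp _ _ _ z.2.1) g).trans ?_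
  congr 1
  apply quotientHom_ext
  rw [ModuleCat.comp_apply, hg, quotientHom_mk, quotientHom_mk, one_smul, one_smul, hz]

end LocalCohomologyInjective

/-- Linear maps on a monotone sequence of submodules glue to a linear map on their union. -/
theorem exists_linearMap_of_monotone_union {S M N : Type*} [Ring S] [AddCommGroup M] [Module S M]
    [AddCommGroup N] [Module S N] (Z : ℕ → Submodule S M) (hZ : Monotone Z) (U : Submodule S M)
    (hU : ∀ x, x ∈ U ↔ ∃ t, x ∈ Z t) (κ : ∀ t, Z t →ₗ[S] N)
    (hκ : ∀ s t, s ≤ t → ∀ x (hs : x ∈ Z s) (ht : x ∈ Z t), κ s ⟨x, hs⟩ = κ t ⟨x, ht⟩) :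
    ∃ ψ : U →ₗ[S] N, ∀ t x (hx : x ∈ Z t), ψ ⟨x, (hU x).2 ⟨t, hx⟩⟩ = κ t ⟨x, hx⟩ := by
  choose τ hτ using fun x : U => (hU x.1).1 x.2
  have key : ∀ (x : U) t (hx : x.1 ∈ Z t), κ (τ x) ⟨x.1, hτ x⟩ = κ t ⟨x.1, hx⟩ := by
    intro x t hx
    rcases le_total (τ x) t with h | h
    · exact hκ _ _ h _ _ _
    · exact (hκ _ _ h _ _ _).symm
  refine ⟨⟨⟨fun x => κ (τ x) ⟨x.1, hτ x⟩, ?_⟩, ?_⟩, ?_⟩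
  · intro x y
    have hx := hZ (le_max_left (τ x) (τ y)) (hτ x)
    have hy := hZ (le_max_right (τ x) (τ y)) (hτ y)
    rw [key x _ hx, key y _ hy, ← map_add, key (x + y) _ (Submodule.add_mem _ hx hy)]
    rfl
  · intro c x
    change κ (τ (c • x)) _ = c • κ (τ x) _
    rw [← map_smul, key (c • x) _ (Submodule.smul_mem _ c (hτ x))]
    rfl
  · intro t x hx
    exact key ⟨x, _⟩ t hx

section LocalCohomologyInjective
variable {S : Type} [CommRing S] {Y : ModuleCat.{0} S} (I : InjectiveResolution Y)

/-- Local cohomology is the cohomology of the complex of torsion elements in an injective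
resolution. -/
theorem exists_localCohomology_linearMap (J : Ideal S) {n m : ℕ} (hm : m + 1 = n) :
    ∃ ψ : (LinearMap.ker (I.cocomplex.d n (n + 1)).hom ⊓ powTorsion J (I.cocomplex.X n) :
        Submodule S (I.cocomplex.X n)) →ₗ[S] (localCohomology J n).obj Y,
      Function.Surjective ψ ∧
      ∀ z, ψ z = 0 ↔ ∃ y ∈ powTorsion J (I.cocomplex.X m), I.cocomplex.d m n y = z.1 := by
  let D := localCohomology.diagram (localCohomology.idealPowersDiagram J) n
  let ev := (evaluation (ModuleCat.{0} S) (ModuleCat.{0} S)).obj Y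
  let c := ev.mapCocone (colimit.cocone D)
  have hc : IsColimit c := isColimitOfPreserves ev (colimit.isColimit D)
  let o : ℕ → ℕᵒᵖᵒᵖ := fun t => Opposite.op (Opposite.op t)
  let κ : ∀ t, (LinearMap.ker (I.cocomplex.d n (n + 1)).hom ⊓
      Submodule.torsionBySet S (I.cocomplex.X n) (J ^ t : Ideal S) :
        Submodule S (I.cocomplex.X n)) →ₗ[S] (localCohomology J n).obj Y := fun t =>
    (c.ι.app (o t)).hom ∘ₗ (extComparison (ModuleCat.of S (S ⧸ J ^ t)) Y n m hm).symm.toLinearMap ∘ₗ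
      quotientExtClass I n (J ^ t)
  have trans : ∀ s t (hst : s ≤ t) x hs ht,
      (D ⋙ ev).map (homOfLE hst).op.op
        ((extComparison (ModuleCat.of S (S ⧸ J ^ s)) Y n m hm).symm (quotientExtClass I n (J ^ s) ⟨x, hs⟩)) =
      (extComparison (ModuleCat.of S (S ⧸ J ^ t)) Y n m hm).symm (quotientExtClass I n (J ^ t) ⟨x, ht⟩) := by
    intro s t hst x hs ht
    refine ((extComparison (ModuleCat.of S (S ⧸ J ^ t)) Y n m hm).eq_symm_apply).2 ?_
    refine (extComparison_map
      ((localCohomology.ringModIdeals (localCohomology.idealPowersDiagram J)).map (homOfLE hst).op)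
      Y n m hm _).trans ?_
    refine (congr_arg (fun e => (Abelian.Ext.mk₀ _).comp e (zero_add n))
      ((extComparison (ModuleCat.of S (S ⧸ J ^ s)) Y n m hm).apply_symm_apply _)).trans ?_
    apply mk₀_comp_quotientExtClass
    · rfl
    · rfl
  have hmono : Monotone fun t => (LinearMap.ker (I.cocomplex.d n (n + 1)).hom ⊓
      Submodule.torsionBySet S (I.cocomplex.X n) (J ^ t : Ideal S) :
        Submodule S (I.cocomplex.X n)) := by
    intro s t hst
    refine inf_le_inf_left _ fun x hx => ?_
    rw [Submodule.mem_torsionBySet_iff] at hx ⊢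
    exact fun a => hx ⟨a, Ideal.pow_le_pow_right hst a.2⟩
  obtain ⟨ψ, hψ⟩ := exists_linearMap_of_monotone_union _ hmono
    (LinearMap.ker (I.cocomplex.d n (n + 1)).hom ⊓ powTorsion J (I.cocomplex.X n))
    (by
      intro x
      simp only [Submodule.mem_inf, mem_powTorsion, Submodule.mem_torsionBySet_iff]
      constructor
      · rintro ⟨h1, t, h2⟩
        exact ⟨t, h1, fun a => h2 a a.2⟩
      · rintro ⟨t, h1, h2⟩
        exact ⟨h1, t, fun a ha => h2 ⟨a, ha⟩⟩) κ
    (by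
      intro s t hst x hs ht
      have := c.w (homOfLE hst).op.op
      have h2 := congr($this ((extComparison (ModuleCat.of S (S ⧸ J ^ s)) Y n m hm).symm
        (quotientExtClass I n (J ^ s) ⟨x, hs⟩)))
      refine h2.symm.trans ?_
      exact congr_arg (c.ι.app (o t)) (trans s t hst x hs ht))
  refine ⟨ψ, ?_, ?_⟩
  · intro y
    obtain ⟨j, w, hw⟩ := Concrete.isColimit_exists_rep (D ⋙ ev) hc y
    let t := j.unop.unop
    obtain ⟨z, hz⟩ := quotientExtClass_surjective I n (J ^ t)
      (extComparison (ModuleCat.of S (S ⧸ J ^ t)) Y n m hm w)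
    refine ⟨_, (hψ t z.1 z.2).trans ?_⟩
    refine Eq.trans (congr_arg (c.ι.app (o t)) ?_) hw
    exact (congr_arg _ hz).trans
      ((extComparison (ModuleCat.of S (S ⧸ J ^ t)) Y n m hm).symm_apply_apply w)
  · rintro ⟨z, hz⟩
    obtain ⟨t, ht⟩ := hz.2
    have hzt : z ∈ (LinearMap.ker (I.cocomplex.d n (n + 1)).hom ⊓
      Submodule.torsionBySet S (I.cocomplex.X n) (J ^ t : Ideal S) :
        Submodule S (I.cocomplex.X n)) := ⟨hz.1, (Submodule.mem_torsionBySet_iff _ _).2 fun a => ht a a.2⟩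
    rw [hψ t z hzt]
    constructor
    · intro h0
      have h1 : c.ι.app (o t) ((extComparison _ Y n m hm).symm (quotientExtClass I n (J ^ t) ⟨z, hzt⟩)) =
        c.ι.app (o t) 0 := h0.trans (map_zero (c.ι.app (o t)).hom).symm
      obtain ⟨k, f, g, hfg⟩ := Concrete.isColimit_exists_of_rep_eq (D ⋙ ev) hc _ _ h1
      have hle : t ≤ k.unop.unop := f.unop.unop.le
      have hf : f = (homOfLE hle).op.op := rfl
      have hzk := hmono hle hzt
      rw [hf] at hfg
      have h2 := (trans t _ hle z hzt hzk).symm.trans (hfg.trans (map_zero ((D ⋙ ev).map g).hom))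
      have h3 := ((extComparison (ModuleCat.of S (S ⧸ J ^ k.unop.unop)) Y n m hm).symm.map_eq_zero_iff).1 h2
      obtain ⟨y, hy1, hy2⟩ := (quotientExtClass_eq_zero_iff I hm _ _).1 h3
      exact ⟨y, ⟨_, hy1⟩, hy2⟩
    · rintro ⟨y, ⟨s, hs⟩, hy⟩
      have hzst := hmono (Nat.le_add_right t s) hzt
      rw [← hψ t z hzt, hψ (t + s) z hzst]
      have : quotientExtClass I n (J ^ (t + s)) ⟨z, hzst⟩ = 0 :=
        (quotientExtClass_eq_zero_iff I hm _ _).2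
          ⟨y, fun a ha => hs a (Ideal.pow_le_pow_right (Nat.le_add_left s t) ha), hy⟩
      refine (congr_arg (c.ι.app (o (t + s))) ?_).trans (map_zero (c.ι.app (o (t + s))).hom)
      exact (congr_arg _ this).trans
        (map_zero (extComparison (ModuleCat.of S (S ⧸ J ^ (t + s))) Y n m hm).symm)
end LocalCohomologyInjective

section Torsion
variable {S : Type} [CommRing S] {M : Type*} [AddCommGroup M] [Module S M]

theorem Module.Baer.exists_extend_of_ker_le {A B : Type*} [AddCommGroup A] [Module S A]
    [AddCommGroup B] [Module S B] (hM : Module.Baer S M) (p : A →ₗ[S] B) (q : A →ₗ[S] M)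
    (h : LinearMap.ker p ≤ LinearMap.ker q) : ∃ φ : B →ₗ[S] M, ∀ a, φ (p a) = q a := by
  obtain ⟨φ, hφ⟩ := hM.extension_property ((LinearMap.ker p).liftQ p le_rfl)
    (LinearMap.ker_eq_bot.1 (Submodule.ker_liftQ_eq_bot _ _ _ le_rfl)) ((LinearMap.ker p).liftQ q h)
  exact ⟨φ, fun a => congr($hφ (Submodule.Quotient.mk a))⟩

theorem powTorsion_map {N : Type*} [AddCommGroup N] [Module S N] {J : Ideal S} (φ : M →ₗ[S] N)
    (x : M) (hx : x ∈ powTorsion J M) : φ x ∈ powTorsion J N := by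
  obtain ⟨t, ht⟩ := hx
  exact ⟨t, fun a ha => by rw [← map_smul, ht a ha, map_zero]⟩

theorem powTorsion_mono {J J' : Ideal S} (h : J ≤ J') : powTorsion J' M ≤ powTorsion J M := by
  rintro x ⟨t, ht⟩
  exact ⟨t, fun a ha => ht a (Ideal.pow_right_mono h t ha)⟩

theorem powTorsion_mono_radical [IsNoetherianRing S] {J J' : Ideal S} (h : J ≤ J'.radical) :
    powTorsion J' M ≤ powTorsion J M := by
  rintro x ⟨t, ht⟩
  obtain ⟨k, hk⟩ := Ideal.exists_pow_le_of_le_radical_of_fg h (IsNoetherian.noetherian _)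
  refine ⟨k * t, fun a ha => ht a ?_⟩
  rw [pow_mul] at ha
  exact Ideal.pow_right_mono hk t ha

theorem mem_powTorsion_singleton {f : S} {x : M} :
    x ∈ powTorsion (Ideal.span {f}) M ↔ ∃ t : ℕ, f ^ t • x = 0 := by
  rw [mem_powTorsion]
  refine exists_congr fun t => ?_
  rw [Ideal.span_singleton_pow]
  refine ⟨fun h => h _ (Ideal.mem_span_singleton_self _), fun h a ha => ?_⟩
  obtain ⟨c, rfl⟩ := Ideal.mem_span_singleton'.1 ha
  rw [mul_smul, h, smul_zero]

theorem powTorsion_sup (J J' : Ideal S) :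
    powTorsion (J ⊔ J') M = powTorsion J M ⊓ powTorsion J' M := by
  refine le_antisymm (le_inf (powTorsion_mono le_sup_left) (powTorsion_mono le_sup_right)) ?_
  rintro x ⟨⟨s, hs⟩, ⟨t, ht⟩⟩
  refine ⟨s + t, fun a ha => ?_⟩
  have := Ideal.sup_pow_add_le_pow_sup_pow ha
  obtain ⟨b, hb, c, hc, rfl⟩ := Submodule.mem_sup.1 this
  rw [add_smul, hs b hb, ht c hc, add_zero]

theorem powTorsion_bot : powTorsion (⊥ : Ideal S) M = ⊤ := by
  refine eq_top_iff.2 fun x _ => ⟨1, fun a ha => ?_⟩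
  rw [pow_one, Ideal.mem_bot] at ha
  rw [ha, zero_smul]

theorem mem_powTorsion_span_cons {f : S} {l : List S} {x : M} :
    x ∈ powTorsion (Ideal.span {a | a ∈ f :: l}) M ↔
      (∃ t : ℕ, f ^ t • x = 0) ∧ x ∈ powTorsion (Ideal.span {a | a ∈ l}) M := by
  have : {a | a ∈ f :: l} = {f} ∪ {a | a ∈ l} := by ext; simp
  rw [this, Ideal.span_union, powTorsion_sup, Submodule.mem_inf, mem_powTorsion_singleton]

/-- The torsion of an injective module over a noetherian ring is divisible up to torsion. -/
theorem exists_mem_powTorsion_pow_smul_eq [IsNoetherianRing S] (hM : Module.Baer S M)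
    (J : Ideal S) (f : S) {w : M} (hw : w ∈ powTorsion J M) (s : ℕ) :
    ∃ w' ∈ powTorsion J M, ∃ r : ℕ, f ^ r • w = f ^ (r + s) • w' := by
  obtain ⟨t, ht⟩ := hw
  obtain ⟨k, hk⟩ := monotone_stabilizes_iff_noetherian.mpr (inferInstance : IsNoetherian S S)
    ⟨fun l => LinearMap.ker (LinearMap.lsmul S S (f ^ l)), by
      intro a b hab x hx
      obtain ⟨c, rfl⟩ := Nat.exists_eq_add_of_le hab
      simp only [LinearMap.mem_ker, LinearMap.lsmul_apply, smul_eq_mul] at hx ⊢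
      rw [pow_add, mul_right_comm, hx, zero_mul]⟩
  have hann : ∀ a : S, a * f ^ (k + s) = 0 → a * f ^ k = 0 := by
    intro a ha
    have h1 : a ∈ LinearMap.ker (LinearMap.lsmul S S (f ^ (k + s))) := by
      simpa [mul_comm] using ha
    have h2 : LinearMap.lsmul S S (f ^ k) a = 0 := (hk (k + s) (Nat.le_add_right k s)).symm.le h1
    simpa [mul_comm] using h2
  obtain ⟨c, hc⟩ := Ideal.exists_pow_inf_eq_pow_smul J (Ideal.span {f ^ (k + s)} : Submodule S S)
  obtain ⟨φ, hφ⟩ := hM.exists_extend_of_ker_le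
    (LinearMap.coprod (LinearMap.mulRight S (f ^ (k + s))) (Submodule.subtype (J ^ (c + t) : Ideal S)))
    ((LinearMap.toSpanSingleton S M (f ^ k • w)).comp (LinearMap.fst S S (J ^ (c + t) : Ideal S))) (by
      rintro ⟨a, b, hb⟩ hab
      simp only [LinearMap.mem_ker, LinearMap.coprod_apply, LinearMap.mulRight_apply,
        Submodule.subtype_apply] at hab
      change a • f ^ k • w = 0
      have hmem : a * f ^ (k + s) ∈ (J ^ (c + t) • ⊤ ⊓ Ideal.span {f ^ (k + s)} : Submodule S S) := by
        refine ⟨?_, Ideal.mul_mem_left _ _ (Ideal.mem_span_singleton_self _)⟩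
        rw [Ideal.smul_eq_mul, Ideal.mul_top, eq_neg_of_add_eq_zero_left hab]
        exact neg_mem hb
      rw [hc (c + t) (Nat.le_add_right c t), Nat.add_sub_cancel_left] at hmem
      have hmem2 : a * f ^ (k + s) ∈ J ^ t * Ideal.span {f ^ (k + s)} :=
        Ideal.mul_mono_right inf_le_right hmem
      obtain ⟨e, he, hea⟩ := Ideal.mem_mul_span_singleton.1 hmem2
      have h3 := hann (a - e) (by rw [sub_mul, hea, sub_self])
      rw [sub_mul, sub_eq_zero] at h3
      rw [← mul_smul, h3, mul_comm, mul_smul, ht e he, smul_zero])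
  refine ⟨φ 1, ⟨c + t, fun a ha => ?_⟩, k, ?_⟩
  · have := hφ (0, ⟨a, ha⟩)
    simp only [LinearMap.coprod_apply, map_zero, Submodule.subtype_apply, zero_add] at this
    rw [← map_smul, smul_eq_mul, mul_one, this]
    simp
  · have := hφ (1, 0)
    simp only [LinearMap.coprod_apply, LinearMap.mulRight_apply, one_mul, map_zero, add_zero] at this
    rw [← map_smul, smul_eq_mul, mul_one, this]
    simp

end Torsion

section Cech
variable {S : Type} [CommRing S]

/-- The ideal generated by the `t`-th powers of the members of a list. -/
def powIdeal (l : List S) (t : ℕ) : Ideal S := Ideal.span ((· ^ t) '' {a | a ∈ l})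

theorem powIdeal_nil (t : ℕ) : powIdeal ([] : List S) t = ⊥ := by simp [powIdeal]

theorem powIdeal_cons (f : S) (l : List S) (t : ℕ) :
    powIdeal (f :: l) t = Ideal.span {f ^ t} ⊔ powIdeal l t := by
  have : {a | a ∈ f :: l} = {f} ∪ {a | a ∈ l} := by ext; simp
  rw [powIdeal, this, Set.image_union, Ideal.span_union, Set.image_singleton]; rfl

theorem mem_powIdeal_cons {f : S} {l : List S} {t : ℕ} {p : S} :
    p ∈ powIdeal (f :: l) t ↔ ∃ c, ∃ e ∈ powIdeal l t, p = f ^ t * c + e := by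
  rw [powIdeal_cons, Submodule.mem_sup]
  constructor
  · rintro ⟨y, hy, z, hz, rfl⟩
    obtain ⟨c, rfl⟩ := Ideal.mem_span_singleton'.1 hy
    exact ⟨c, z, hz, by rw [mul_comm]⟩
  · rintro ⟨c, e, he, rfl⟩
    exact ⟨_, Ideal.mem_span_singleton'.2 ⟨c, mul_comm _ _⟩, e, he, rfl⟩

theorem prod_pow_mul_mem_powIdeal (l : List S) (t w : ℕ) {p : S} (hp : p ∈ powIdeal l t) :
    l.prod ^ w * p ∈ powIdeal l (t + w) := by
  refine Submodule.span_induction (p := fun p _ => l.prod ^ w * p ∈ powIdeal l (t + w))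
    ?_ (by simp) ?_ ?_ hp
  · rintro _ ⟨b, hb, rfl⟩
    obtain ⟨c, hc⟩ := List.dvd_prod hb
    have : l.prod ^ w * b ^ t = c ^ w * b ^ (t + w) := by rw [hc]; ring
    change l.prod ^ w * b ^ t ∈ _
    rw [this]
    exact Ideal.mul_mem_left _ _ (Ideal.subset_span ⟨b, hb, rfl⟩)
  · intro x y _ _ hx hy
    rw [mul_add]
    exact add_mem hx hy
  · intro a x _ hx
    rw [smul_eq_mul, mul_left_comm]
    exact Ideal.mul_mem_left _ _ hx

variable (X : ℕ → Type) [∀ n, AddCommGroup (X n)] [∀ n, Module S (X n)]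
  (d : ∀ n, X n →ₗ[S] X (n + 1)) (ε : S →ₗ[S] X 0)

/-- An injective resolution of the ring `S`, in elementary terms. -/
structure IsInjectiveResolution : Prop where
  baer : ∀ n, Module.Baer S (X n)
  comp : ∀ n x, d (n + 1) (d n x) = 0
  exact : ∀ n x, d (n + 1) x = 0 → ∃ y, d n y = x
  inj : Function.Injective ε
  comp_zero : ∀ p, d 0 (ε p) = 0
  exact_zero : ∀ x, d 0 x = 0 → ∃ p, ε p = x

/-- The elements killed by a power of the ideal generated by a list. -/
abbrev listTorsion (l : List S) (n : ℕ) : Submodule S (X n) :=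
  powTorsion (Ideal.span {a | a ∈ l}) (X n)

variable {X} in
/-- Boundaries of the complex of torsion elements. -/
def torsionBoundary (l : List S) : ∀ n, Submodule S (X n)
  | 0 => ⊥
  | n + 1 => (listTorsion X l n).map (d n)

variable {X} in
/-- Connecting maps send the fraction `p / (∏ l) ^ t` to cocycles of the complex of
torsion elements in an injective resolution of `S`. -/
def cechRel : ∀ l : List S, ℕ → S → X l.length → Prop
  | [], _, p, z => z = ε p
  | f :: l, t, p, z => ∃ z₀ z', ∃ r : ℕ, cechRel l t p z₀ ∧ z' ∈ listTorsion X l l.length ∧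
      f ^ r • z₀ = f ^ (r + t) • z' ∧ z = d l.length z'

namespace IsInjectiveResolution
variable {X d ε} [IsNoetherianRing S] (h : IsInjectiveResolution X d ε)
include h

theorem exists_torsion_lift (l : List S) : ∀ n, l.length < n + 1 → ∀ z ∈ listTorsion X l (n + 1),
    d (n + 1) z = 0 → ∃ y ∈ listTorsion X l n, d n y = z := by
  induction l with
  | nil =>
    intro n _ z _ hz
    obtain ⟨y, hy⟩ := h.exact n z hz
    refine ⟨y, ?_, hy⟩
    have : listTorsion X ([] : List S) n = ⊤ := by
      rw [listTorsion]; convert powTorsion_bot; simp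
    rw [this]; trivial
  | cons f l ih =>
    intro n hn z hz hdz
    obtain ⟨n, rfl⟩ : ∃ k, n = k + 1 := ⟨n - 1, by simp at hn; omega⟩
    have hn' : l.length < n + 1 := by simpa using hn
    obtain ⟨⟨s, hs⟩, hzl⟩ := mem_powTorsion_span_cons.1 hz
    obtain ⟨y, hy, rfl⟩ := ih (n + 1) (by omega) z hzl hdz
    obtain ⟨w, hw, hwy⟩ := ih n hn' (f ^ s • y) (Submodule.smul_mem _ _ hy)
      (by rw [map_smul, hs])
    obtain ⟨w', hw', r, hr⟩ := exists_mem_powTorsion_pow_smul_eq (h.baer n) _ f hw s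
    refine ⟨y - d n w', mem_powTorsion_span_cons.2 ⟨⟨r + s, ?_⟩, ?_⟩, ?_⟩
    · rw [smul_sub, ← map_smul, ← hr, map_smul, hwy, pow_add, mul_smul, sub_self]
    · exact sub_mem hy (powTorsion_map _ _ hw')
    · rw [map_sub, h.comp, sub_zero]

omit [IsNoetherianRing S] in
theorem torsionBoundary_closed (l : List S) : ∀ n, ∀ z ∈ torsionBoundary d l n,
    d n z = 0 ∧ z ∈ listTorsion X l n
  | 0, z, hz => by
    rw [(Submodule.mem_bot S).1 hz]; exact ⟨map_zero _, zero_mem _⟩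
  | n + 1, z, hz => by
    obtain ⟨y, hy, rfl⟩ := hz
    exact ⟨h.comp n y, powTorsion_map _ _ hy⟩

theorem torsionBoundary_divisible (l : List S) (f : S) (s : ℕ) : ∀ n, ∀ z ∈ torsionBoundary d l n,
    ∃ z' ∈ torsionBoundary d l n, ∃ r : ℕ, f ^ r • z = f ^ (r + s) • z'
  | 0, z, hz => ⟨0, zero_mem _, 0, by rw [(Submodule.mem_bot S).1 hz]; simp⟩
  | n + 1, z, hz => by
    obtain ⟨y, hy, rfl⟩ := hz
    obtain ⟨w', hw', r, hr⟩ := exists_mem_powTorsion_pow_smul_eq (h.baer n) _ f hy s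
    exact ⟨d n w', ⟨w', hw', rfl⟩, r, by rw [← map_smul, hr, map_smul]⟩

omit [IsNoetherianRing S] in
theorem cechRel_closed : ∀ (l : List S) (t p z), cechRel d ε l t p z →
    d l.length z = 0 ∧ z ∈ listTorsion X l l.length
  | [], t, p, z, hz => by
    have hz : z = ε p := hz
    refine ⟨by rw [hz]; exact h.comp_zero p, ?_⟩
    have : listTorsion X ([] : List S) ([] : List S).length = ⊤ := by
      rw [listTorsion]; convert powTorsion_bot; simp
    rw [this]; trivial
  | f :: l, t, p, z, ⟨z₀, z', r, h₀, hz', hr, hz⟩ => by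
    obtain ⟨h1, -⟩ := cechRel_closed l t p z₀ h₀
    rw [hz]
    refine ⟨h.comp _ _, mem_powTorsion_span_cons.2 ⟨⟨r + t, ?_⟩, powTorsion_map _ _ hz'⟩⟩
    rw [← map_smul, ← hr, map_smul, h1, smul_zero]

theorem exists_cechRel : ∀ (l : List S) (t p), ∃ z, cechRel d ε l t p z
  | [], t, p => ⟨ε p, rfl⟩
  | f :: l, t, p => by
    obtain ⟨z₀, h₀⟩ := exists_cechRel l t p
    obtain ⟨z', hz', r, hr⟩ := exists_mem_powTorsion_pow_smul_eq (h.baer l.length) _ f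
      (h.cechRel_closed l t p z₀ h₀).2 t
    exact ⟨_, z₀, z', r, h₀, hz', hr, rfl⟩

omit h [IsNoetherianRing S] in
theorem _root_.cechRel_add : ∀ (l : List S) (t p q z w), cechRel d ε l t p z → cechRel d ε l t q w →
    cechRel d ε l t (p + q) (z + w)
  | [], t, p, q, z, w, hz, hw => by
    have hz : z = ε p := hz
    have hw : w = ε q := hw
    change z + w = ε (p + q)
    rw [hz, hw, map_add]
  | f :: l, t, p, q, z, w, ⟨z₀, z', r, h₀, hz', hr, hz⟩, ⟨w₀, w', r', k₀, hw', hr', hw⟩ => by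
    refine ⟨z₀ + w₀, z' + w', r + r', cechRel_add l t p q _ _ h₀ k₀, add_mem hz' hw', ?_, ?_⟩
    · rw [smul_add, smul_add]
      congr 1
      · rw [add_comm r r', pow_add, mul_smul, hr, add_assoc, pow_add f r', mul_smul]
      · rw [pow_add, mul_smul, hr', add_assoc, pow_add f r, mul_smul]
    · rw [map_add, hz, hw]

omit h [IsNoetherianRing S] in
theorem _root_.cechRel_smul (a : S) : ∀ (l : List S) (t p z), cechRel d ε l t p z →
    cechRel d ε l t (a * p) (a • z)
  | [], t, p, z, hz => by
    have hz : z = ε p := hz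
    change a • z = ε (a * p)
    rw [hz, ← smul_eq_mul, map_smul]
  | f :: l, t, p, z, ⟨z₀, z', r, h₀, hz', hr, hz⟩ => by
    refine ⟨a • z₀, a • z', r, cechRel_smul a l t p z₀ h₀, Submodule.smul_mem _ _ hz', ?_, ?_⟩
    · rw [smul_comm, hr, smul_comm]
    · rw [hz, map_smul]

omit h [IsNoetherianRing S] in
theorem _root_.cechRel_succ : ∀ (l : List S) (t p z), cechRel d ε l t p z →
    cechRel d ε l (t + 1) (l.prod * p) z
  | [], t, p, z, hz => by
    have hz : z = ε p := hz
    change z = ε (1 * p)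
    rw [one_mul, hz]
  | f :: l, t, p, z, ⟨z₀, z', r, h₀, hz', hr, hz⟩ => by
    refine ⟨f • z₀, z', r, ?_, hz', ?_, hz⟩
    · rw [List.prod_cons, mul_assoc]
      exact cechRel_smul f l _ _ _ (cechRel_succ l t p z₀ h₀)
    · rw [smul_comm, hr, ← mul_smul, ← pow_succ']; rfl

omit h [IsNoetherianRing S] in
theorem _root_.cechRel_shift (l : List S) (t u : ℕ) (p z) (hz : cechRel d ε l t p z) :
    cechRel d ε l (t + u) (l.prod ^ u * p) z := by
  induction u with
  | zero => simpa using hz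
  | succ u ih =>
    have := cechRel_succ l _ _ _ ih
    rwa [← mul_assoc, ← pow_succ'] at this

theorem exists_cechRel_of_closed : ∀ (l : List S), ∀ z ∈ listTorsion X l l.length,
    d l.length z = 0 → ∃ t p z₀, cechRel d ε l t p z₀ ∧ z - z₀ ∈ torsionBoundary d l l.length
  | [], z, _, hz => by
    obtain ⟨p, hp⟩ := h.exact_zero z hz
    exact ⟨0, p, z, hp.symm, by rw [sub_self]; exact zero_mem _⟩
  | f :: l, z, hz, hdz => by
    obtain ⟨⟨t, ht⟩, hzl⟩ := mem_powTorsion_span_cons.1 hz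
    obtain ⟨y, hy, rfl⟩ := h.exists_torsion_lift l l.length (Nat.lt_succ_self _) z hzl hdz
    obtain ⟨t', p, z₀, hp, hb⟩ := exists_cechRel_of_closed l (f ^ t • y)
      (Submodule.smul_mem _ _ hy) (by rw [map_smul]; exact ht)
    obtain ⟨b, hb', r, hr⟩ := h.torsionBoundary_divisible l f t _ _ hb
    obtain ⟨hb1, hb2⟩ := h.torsionBoundary_closed l _ _ hb'
    refine ⟨t' + t, f ^ t' * (l.prod ^ t * p), d l.length y, ⟨f ^ t' • z₀, y - b, r,
      cechRel_smul _ l _ _ _ (cechRel_shift l t' t p z₀ hp), sub_mem hy hb2, ?_, ?_⟩, ?_⟩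
    · have e : f ^ r • z₀ = f ^ (r + t) • (y - b) := by
        rw [smul_sub, ← hr, smul_sub, pow_add, mul_smul]; abel
      rw [smul_comm, e, ← mul_smul, ← pow_add]
      congr 2; omega
    · rw [map_sub, hb1, sub_zero]
    · change _ ∈ torsionBoundary d (f :: l) (l.length + 1)
      rw [sub_self]; exact zero_mem _

theorem mem_torsionBoundary_iff : ∀ (l : List S) (t p z), cechRel d ε l t p z →
    (z ∈ torsionBoundary d l l.length ↔ ∃ r : ℕ, l.prod ^ r * p ∈ powIdeal l (t + r))
  | [], t, p, z, hz => by
    have hz : z = ε p := hz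
    change z ∈ (⊥ : Submodule S _) ↔ _
    simp only [powIdeal_nil, Ideal.mem_bot, List.prod_nil, one_pow, one_mul, exists_const]
    rw [Submodule.mem_bot, hz]
    exact map_eq_zero_iff ε h.inj
  | f :: l, t, p, z, ⟨z₀, z', r, h₀, hz', hr, hz⟩ => by
    obtain ⟨c₁, -⟩ := h.cechRel_closed l t p z₀ h₀
    constructor
    · rintro ⟨v, hv, hvz⟩
      obtain ⟨⟨a, ha⟩, hvl⟩ := mem_powTorsion_span_cons.1 hv
      have hvz : d l.length v = z := hvz
      obtain ⟨t', q, k₀, hq, hb⟩ := h.exists_cechRel_of_closed l (z' - v) (sub_mem hz' hvl)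
        (by rw [map_sub, hvz, hz, sub_self])
      have e1 : f ^ (r + a) • z₀ = f ^ (r + a + t) • (z' - v) := by
        have : f ^ (r + a + t) • v = 0 := by
          rw [show r + a + t = (r + t) + a by omega, pow_add, mul_smul, ha, smul_zero]
        rw [smul_sub, this, sub_zero, add_comm r a, pow_add, mul_smul, hr, ← mul_smul, ← pow_add,
          add_assoc]
      have e2 := cechRel_add l _ _ _ _ _
        (cechRel_smul (f ^ (r + a)) l _ _ _ (cechRel_shift l t t' p z₀ h₀))
        (cechRel_smul (-f ^ (r + a + t)) l _ _ _ (by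
          have := cechRel_shift l t' t q k₀ hq; rwa [add_comm t' t] at this))
      obtain ⟨v', hv'⟩ := (mem_torsionBoundary_iff l _ _ _ e2).1 (by
        rw [e1, neg_smul, ← sub_eq_add_neg, ← smul_sub]
        exact Submodule.smul_mem _ _ hb)
      refine ⟨r + a + t' + v', mem_powIdeal_cons.2 ⟨l.prod ^ (r + a) * l.prod ^ v' * l.prod ^ t * q,
        l.prod ^ (r + a) * (f ^ (t' + v') * (l.prod ^ v' *
          (f ^ (r + a) * (l.prod ^ t' * p) + -f ^ (r + a + t) * (l.prod ^ t * q)))), ?_, ?_⟩⟩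
      · have := prod_pow_mul_mem_powIdeal l _ (r + a) (Ideal.mul_mem_left _ (f ^ (t' + v')) hv')
        rwa [show t + (r + a + t' + v') = t + t' + v' + (r + a) by omega]
      · rw [List.prod_cons]; ring
    · rintro ⟨w, hw⟩
      obtain ⟨c, e, he, hce⟩ := mem_powIdeal_cons.1 hw
      obtain ⟨k₀, hk₀⟩ := h.exists_cechRel l (t + w) c
      have e2 := cechRel_add l _ _ _ _ _
        (cechRel_smul (f ^ w) l _ _ _ (cechRel_shift l t w p z₀ h₀))
        (cechRel_smul (-f ^ (t + w)) l _ _ _ hk₀)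
      have hb := (mem_torsionBoundary_iff l _ _ _ e2).2 ⟨0, by
        rw [List.prod_cons] at hce
        have : l.prod ^ 0 * (f ^ w * (l.prod ^ w * p) + -f ^ (t + w) * c) = e := by
          linear_combination hce
        rw [this]; exact he⟩
      obtain ⟨b, hb', s, hs⟩ := h.torsionBoundary_divisible l f (t + w) _ _ hb
      obtain ⟨hb1, hb2⟩ := h.torsionBoundary_closed l _ _ hb'
      obtain ⟨k1, k2⟩ := h.cechRel_closed l _ _ _ hk₀
      refine ⟨z' - (k₀ + b), mem_powTorsion_span_cons.2 ⟨⟨s + w + (r + t), ?_⟩,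
        sub_mem hz' (add_mem k2 hb2)⟩, ?_⟩
      · rw [smul_sub, pow_add, mul_smul, ← hr, ← pow_add, sub_eq_zero]
        have e3 : f ^ s • f ^ w • z₀ = f ^ (s + (t + w)) • (k₀ + b) := by
          rw [smul_add, ← hs, neg_smul, smul_add, smul_neg, ← mul_smul (f ^ s) (f ^ (t + w)) k₀,
            ← pow_add]
          abel
        rw [← mul_smul, ← pow_add, show s + w + r = r + (s + w) by omega, pow_add, mul_smul,
          pow_add f s w, mul_smul, e3, ← mul_smul, ← pow_add]
        congr 2; omega
      · rw [map_sub, map_add, hb1, k1, hz]; simp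

end IsInjectiveResolution
end Cech

section TorsionComparison
variable {S : Type} [CommRing S] [IsNoetherianRing S] {M : Type*} [AddCommGroup M] [Module S M]

theorem exists_sub_mem_powTorsion_singleton (hM : Module.Baer S M) {J J' : Ideal S} {α : S}
    (h : Ideal.span {α} * J' ≤ J.radical) {y : M} (hy : y ∈ powTorsion J M) :
    ∃ b ∈ powTorsion J' M, y - b ∈ powTorsion (Ideal.span {α}) M := by
  obtain ⟨t, ht⟩ := powTorsion_mono_radical h hy
  have h1 : α ^ t • y ∈ powTorsion J' M := by
    refine ⟨t, fun c hc => ?_⟩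
    rw [← mul_smul]
    refine ht _ ?_
    rw [mul_pow, mul_comm c]
    exact Ideal.mul_mem_mul (Ideal.pow_mem_pow (Ideal.mem_span_singleton_self α) t) hc
  obtain ⟨b, hb, r, hr⟩ := exists_mem_powTorsion_pow_smul_eq hM J' α h1 t
  refine ⟨b, hb, mem_powTorsion_singleton.2 ⟨r + t, ?_⟩⟩
  rw [smul_sub, ← hr, pow_add, mul_smul, sub_self]

theorem exists_sub_mem_powTorsion (hM : Module.Baer S M) {J J' : Ideal S} {α δ : S}
    (hJ : J ≤ J') (hα : Ideal.span {α} * J' ≤ J.radical)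
    (hδ : Ideal.span {δ} * (J' ⊔ Ideal.span {α}) ≤ (J ⊔ Ideal.span {α}).radical)
    {y : M} (hy : y ∈ powTorsion J M) :
    ∃ b ∈ powTorsion J' M, y - b ∈ powTorsion (J ⊔ Ideal.span {α} ⊔ Ideal.span {δ}) M := by
  obtain ⟨b₁, hb₁, h₁⟩ := exists_sub_mem_powTorsion_singleton hM hα hy
  have hy₁ : y - b₁ ∈ powTorsion (J ⊔ Ideal.span {α}) M := by
    rw [powTorsion_sup]
    exact ⟨sub_mem hy (powTorsion_mono hJ hb₁), h₁⟩
  obtain ⟨b₂, hb₂, h₂⟩ := exists_sub_mem_powTorsion_singleton hM hδ hy₁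
  refine ⟨b₁ + b₂, add_mem hb₁ (powTorsion_mono le_sup_left hb₂), ?_⟩
  rw [powTorsion_sup, ← sub_sub]
  exact ⟨sub_mem hy₁ (powTorsion_mono (sup_le_sup_right hJ _) hb₂), h₂⟩

omit [IsNoetherianRing S] in
theorem powTorsion_inf_le (J J' J'' : Ideal S) :
    powTorsion J' M ⊓ powTorsion (J ⊔ J'') M ≤ powTorsion (J' ⊔ J'') M := by
  rw [powTorsion_sup, powTorsion_sup]
  exact fun x hx => ⟨hx.1, hx.2.2⟩

variable {X : ℕ → Type} [∀ n, AddCommGroup (X n)] [∀ n, Module S (X n)]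
  {d : ∀ n, X n →ₗ[S] X (n + 1)} {ε : S →ₗ[S] X 0}

/-- Comparison of the top local cohomology modules of two ideals that agree, up to radical, with
two smaller ideals generated by few elements away from the zero loci of `α` and `δ`. -/
theorem IsInjectiveResolution.torsion_comparison (h : IsInjectiveResolution X d ε)
    {l l' : List S} {k : ℕ} (hl : l.length ≤ k) (hl' : l'.length ≤ k) {α δ : S}
    (hJ : Ideal.span {a | a ∈ l} ≤ Ideal.span {a | a ∈ l'})
    (hα : Ideal.span {α} * Ideal.span {a | a ∈ l'} ≤ (Ideal.span {a | a ∈ l}).radical)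
    (hδ : Ideal.span {δ} * (Ideal.span {a | a ∈ l'} ⊔ Ideal.span {α}) ≤
      (Ideal.span {a | a ∈ l} ⊔ Ideal.span {α}).radical) :
    (∀ z ∈ powTorsion (Ideal.span {a | a ∈ l} ⊔ Ideal.span {α} ⊔ Ideal.span {δ}) (X (k + 2)),
      d (k + 2) z = 0 → ∃ y ∈ powTorsion (Ideal.span {a | a ∈ l} ⊔ Ideal.span {α} ⊔ Ideal.span {δ})
        (X (k + 1)), z - d (k + 1) y ∈
          powTorsion (Ideal.span {a | a ∈ l'} ⊔ Ideal.span {α} ⊔ Ideal.span {δ}) (X (k + 2))) ∧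
    (∀ z ∈ powTorsion (Ideal.span {a | a ∈ l'} ⊔ Ideal.span {α} ⊔ Ideal.span {δ}) (X (k + 2)),
      ∀ y ∈ powTorsion (Ideal.span {a | a ∈ l} ⊔ Ideal.span {α} ⊔ Ideal.span {δ}) (X (k + 1)),
        d (k + 1) y = z → ∃ y' ∈ powTorsion (Ideal.span {a | a ∈ l'} ⊔ Ideal.span {α} ⊔
          Ideal.span {δ}) (X (k + 1)), d (k + 1) y' = z) := by
  constructor
  · intro z hz hdz
    have hzA : z ∈ listTorsion X l (k + 2) := by
      rw [sup_assoc] at hz; exact powTorsion_mono le_sup_left hz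
    obtain ⟨y, hy, hyz⟩ := h.exists_torsion_lift l (k + 1) (by omega) z hzA hdz
    obtain ⟨b, hb, hyb⟩ := exists_sub_mem_powTorsion (h.baer _) hJ hα hδ hy
    refine ⟨y - b, hyb, ?_⟩
    rw [sup_assoc]
    refine powTorsion_inf_le (Ideal.span {a | a ∈ l}) _ _ ⟨?_, ?_⟩
    · rw [map_sub, hyz, sub_sub_cancel]
      exact powTorsion_map _ _ hb
    · rw [← sup_assoc]
      exact sub_mem hz (powTorsion_map _ _ hyb)
  · intro z hz y hy hyz
    have hzB : z ∈ listTorsion X l' (k + 2) := by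
      rw [sup_assoc] at hz; exact powTorsion_mono le_sup_left hz
    have hyA : y ∈ listTorsion X l (k + 1) := by
      rw [sup_assoc] at hy; exact powTorsion_mono le_sup_left hy
    obtain ⟨b, hb, hbz⟩ := h.exists_torsion_lift l' (k + 1) (by omega) z hzB
      (by rw [← hyz, h.comp])
    obtain ⟨a, ha, hab⟩ := h.exists_torsion_lift l k (by omega) (y - b)
      (sub_mem hyA (powTorsion_mono hJ hb)) (by rw [map_sub, hyz, hbz, sub_self])
    obtain ⟨b', hb', hyb⟩ := exists_sub_mem_powTorsion (h.baer _) hJ hα hδ ha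
    refine ⟨y - d k (a - b'), ?_, by rw [map_sub, h.comp, sub_zero, hyz]⟩
    rw [sup_assoc]
    refine powTorsion_inf_le (Ideal.span {a | a ∈ l}) _ _ ⟨?_, ?_⟩
    · have e : y - d k (a - b') = d k b' + b := by rw [map_sub, hab]; abel
      rw [e]
      exact add_mem (powTorsion_map _ _ hb') hb
    · rw [← sup_assoc]
      exact sub_mem hy (powTorsion_map _ _ hyb)

end TorsionComparison

section LocalCohomologyCech
variable {S : Type} [CommRing S]

theorem InjectiveResolution.isInjectiveResolution (I : InjectiveResolution (ModuleCat.of S S)) :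
    IsInjectiveResolution (fun n => I.cocomplex.X n) (fun n => (I.cocomplex.d n (n + 1)).hom)
      (I.ι.f 0).hom where
  baer n := by
    have : Injective (ModuleCat.of S (I.cocomplex.X n)) := I.injective n
    exact Module.Baer.of_injective (Module.injective_module_of_injective_object S _)
  comp n x := congr($(I.cocomplex.d_comp_d n (n + 1) (n + 2)) x)
  exact n x hx := by
    have := (ShortComplex.moduleCat_exact_iff _).1 (I.exact_succ n) x hx
    exact this
  inj := by
    have : Mono (I.ι.f 0) := inferInstance
    exact (ModuleCat.mono_iff_injective _).1 this
  comp_zero p := congr($(I.ι_f_zero_comp_complex_d) p)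
  exact_zero x hx := by
    have := (ShortComplex.moduleCat_exact_iff _).1 I.exact₀ x hx
    exact this

/-- A linear relation that is bijective is a linear equivalence. -/
theorem LinearEquiv.nonempty_of_relation {A B : Type*} [AddCommGroup A] [AddCommGroup B]
    [Module S A] [Module S B] (R : Submodule S (A × B))
    (hA : ∀ a, ∃ b, (a, b) ∈ R) (hB : ∀ b, ∃ a, (a, b) ∈ R)
    (h : ∀ a b, (a, b) ∈ R → (a = 0 ↔ b = 0)) : Nonempty (A ≃ₗ[S] B) := by
  refine ⟨LinearEquiv.ofKerEq (LinearMap.fst S A B ∘ₗ R.subtype) (LinearMap.snd S A B ∘ₗ R.subtype)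
    (fun a => ?_) (fun b => ?_) ?_⟩
  · obtain ⟨b, hb⟩ := hA a
    exact ⟨⟨_, hb⟩, rfl⟩
  · obtain ⟨a, ha⟩ := hB b
    exact ⟨⟨_, ha⟩, rfl⟩
  · ext ⟨⟨a, b⟩, hab⟩
    exact h a b hab

/-- A module presented as the colimit of the quotients of `S` by the powers of the members of
a list `l`, with transition maps given by the product of `l`. -/
structure IsTopCech (l : List S) {W : Type} [AddCommGroup W] [Module S W]
    (φ : ℕ → S →ₗ[S] W) : Prop where
  succ : ∀ t p, φ (t + 1) (l.prod * p) = φ t p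
  surj : ∀ w, ∃ t p, φ t p = w
  ker : ∀ t p, φ t p = 0 ↔ ∃ r : ℕ, l.prod ^ r * p ∈ powIdeal l (t + r)

theorem IsTopCech.shift {l : List S} {W : Type} [AddCommGroup W] [Module S W]
    {φ : ℕ → S →ₗ[S] W} (h : IsTopCech l φ) (t u : ℕ) (p : S) :
    φ (t + u) (l.prod ^ u * p) = φ t p := by
  induction u with
  | zero => simp
  | succ u ih =>
    have := h.succ (t + u) (l.prod ^ u * p)
    rw [← mul_assoc, ← pow_succ'] at this
    exact this.trans ih

/-- Local cohomology of a noetherian ring in degree the number of generators of the ideal. -/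
theorem IsTopCech.localCohomology_equiv [IsNoetherianRing S] {l : List S} {W : Type}
    [AddCommGroup W] [Module S W] {φ : ℕ → S →ₗ[S] W} (h : IsTopCech l φ) (hl : l ≠ []) :
    Nonempty ((localCohomology (Ideal.span {a | a ∈ l}) l.length).obj (ModuleCat.of S S) ≃ₗ[S]
      W) := by
  let I : InjectiveResolution (ModuleCat.of S S) := InjectiveResolution.of _
  have hI := InjectiveResolution.isInjectiveResolution I
  obtain ⟨f, l, rfl⟩ := List.exists_cons_of_ne_nil hl
  obtain ⟨ψ, hψ, hψ0⟩ := exists_localCohomology_linearMap I (Ideal.span {a | a ∈ f :: l})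
    (n := (f :: l).length) (m := l.length) rfl
  let rel := cechRel (fun n => (I.cocomplex.d n (n + 1)).hom) (I.ι.f 0).hom
  refine LinearEquiv.nonempty_of_relation (S := S)
    { carrier := {x | ∃ t p z, rel (f :: l) t p z.1 ∧ ψ z = x.1 ∧ φ t p = x.2}
      zero_mem' := ?_
      add_mem' := ?_
      smul_mem' := ?_ } ?_ ?_ ?_
  · rintro ⟨a, b⟩ ⟨a', b'⟩ ⟨t, p, z, h1, h2, h3⟩ ⟨t', p', z', h1', h2', h3'⟩
    refine ⟨t + t', (f :: l).prod ^ t' * p + (f :: l).prod ^ t * p', z + z', ?_, ?_, ?_⟩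
    · refine cechRel_add _ _ _ _ _ _ (cechRel_shift _ _ _ _ _ h1) ?_
      rw [add_comm]; exact cechRel_shift _ _ _ _ _ h1'
    · exact (map_add ψ z z').trans (congr_arg₂ _ h2 h2')
    · rw [map_add, h.shift, add_comm t, h.shift, h3, h3']; rfl
  · obtain ⟨z, hz⟩ := hI.exists_cechRel (f :: l) 0 0
    have h0 := cechRel_smul (0 : S) _ _ _ _ hz
    rw [zero_mul, zero_smul] at h0
    exact ⟨0, 0, 0, h0, map_zero ψ, map_zero _⟩
  · rintro c ⟨a, b⟩ ⟨t, p, z, h1, h2, h3⟩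
    refine ⟨t, c * p, c • z, cechRel_smul c _ _ _ _ h1, ?_, ?_⟩
    · exact (map_smul ψ c z).trans (congr_arg (c • ·) h2)
    · rw [← smul_eq_mul, map_smul, h3]; rfl
  · intro a
    obtain ⟨z, rfl⟩ := hψ a
    obtain ⟨t, p, z₀, hz₀, y, hy, hyz⟩ := hI.exists_cechRel_of_closed (f :: l) z.1 z.2.2 z.2.1
    have c := hI.cechRel_closed _ _ _ _ hz₀
    refine ⟨φ t p, t, p, ⟨z₀, c.1, c.2⟩, hz₀, ?_, rfl⟩
    refine (sub_eq_zero.1 ?_).symm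
    refine (map_sub ψ _ _).symm.trans ((hψ0 _).2 ⟨y, hy, hyz⟩)
  · intro b
    obtain ⟨t, p, rfl⟩ := h.surj b
    obtain ⟨z, hz⟩ := hI.exists_cechRel (f :: l) t p
    have c := hI.cechRel_closed _ _ _ _ hz
    exact ⟨ψ ⟨z, c.1, c.2⟩, t, p, ⟨z, c.1, c.2⟩, hz, rfl, rfl⟩
  · rintro _ _ ⟨t, p, z, hz, rfl, rfl⟩
    refine (hψ0 z).trans (Iff.trans ?_ (h.ker t p).symm)
    exact hI.mem_torsionBoundary_iff (f :: l) t p z.1 hz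

theorem localCohomology_equiv_of_torsion_comparison [IsNoetherianRing S] {l l' : List S} {k : ℕ}
    (hl : l.length ≤ k) (hl' : l'.length ≤ k) {α δ : S}
    (hJ : Ideal.span {a | a ∈ l} ≤ Ideal.span {a | a ∈ l'})
    (hα : Ideal.span {α} * Ideal.span {a | a ∈ l'} ≤ (Ideal.span {a | a ∈ l}).radical)
    (hδ : Ideal.span {δ} * (Ideal.span {a | a ∈ l'} ⊔ Ideal.span {α}) ≤
      (Ideal.span {a | a ∈ l} ⊔ Ideal.span {α}).radical)
    {I₁ I₂ : Ideal S}
    (hI₁ : I₁.radical = (Ideal.span {a | a ∈ l} ⊔ Ideal.span {α} ⊔ Ideal.span {δ}).radical)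
    (hI₂ : I₂ = Ideal.span {a | a ∈ l'} ⊔ Ideal.span {α} ⊔ Ideal.span {δ}) :
    Nonempty ((localCohomology I₁ (k + 2)).obj (ModuleCat.of S S) ≃ₗ[S]
      (localCohomology I₂ (k + 2)).obj (ModuleCat.of S S)) := by
  let I : InjectiveResolution (ModuleCat.of S S) := InjectiveResolution.of _
  have hI := InjectiveResolution.isInjectiveResolution I
  obtain ⟨ψ₁, hψ₁, h₁⟩ := exists_localCohomology_linearMap I I₁ (n := k + 2) (m := k + 1) rfl
  obtain ⟨ψ₂, hψ₂, h₂⟩ := exists_localCohomology_linearMap I I₂ (n := k + 2) (m := k + 1) rfl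
  have key := hI.torsion_comparison hl hl' hJ hα hδ
  have e : ∀ n, powTorsion I₁ (I.cocomplex.X n) =
      powTorsion (Ideal.span {a | a ∈ l} ⊔ Ideal.span {α} ⊔ Ideal.span {δ}) (I.cocomplex.X n) :=
    fun n => le_antisymm (powTorsion_mono_radical (hI₁ ▸ Ideal.le_radical))
      (powTorsion_mono_radical (hI₁ ▸ Ideal.le_radical))
  have hle : I₁ ≤ I₂.radical := by
    refine Ideal.le_radical.trans ?_
    rw [hI₁, hI₂]
    exact Ideal.radical_mono (sup_le_sup_right (sup_le_sup_right hJ _) _)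
  have hsub : (LinearMap.ker (I.cocomplex.d (k + 2) (k + 2 + 1)).hom ⊓
      powTorsion I₂ (I.cocomplex.X (k + 2)) : Submodule S (I.cocomplex.X (k + 2))) ≤
      LinearMap.ker (I.cocomplex.d (k + 2) (k + 2 + 1)).hom ⊓
        powTorsion I₁ (I.cocomplex.X (k + 2)) :=
    inf_le_inf_left _ (powTorsion_mono_radical hle)
  refine ⟨(LinearEquiv.ofKerEq ψ₂ (ψ₁ ∘ₗ Submodule.inclusion hsub) hψ₂ ?_ ?_).symm⟩
  · intro x
    obtain ⟨z, rfl⟩ := hψ₁ x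
    have hz2 := (e (k + 2)).le z.2.2
    obtain ⟨y, hy, hyz⟩ := key.1 z.1 hz2 z.2.1
    rw [← hI₂] at hyz
    refine ⟨⟨_, ?_, hyz⟩, ?_⟩
    · exact (map_sub (I.cocomplex.d (k + 2) (k + 2 + 1)).hom _ _).trans
        ((congr_arg₂ _ z.2.1 (hI.comp _ _)).trans (sub_zero _))
    · refine (sub_eq_zero.1 ?_).symm
      refine (map_sub ψ₁ _ _).symm.trans ((h₁ _).2 ⟨y, by rw [e]; exact hy, ?_⟩)
      exact (sub_sub_cancel _ _).symm
  · ext z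
    refine (h₂ z).trans (Iff.trans ?_ (h₁ (Submodule.inclusion hsub z)).symm)
    constructor
    · rintro ⟨y, hy, hyz⟩
      exact ⟨y, powTorsion_mono_radical hle hy, hyz⟩
    · rintro ⟨y, hy, hyz⟩
      rw [e] at hy
      have hz2 := (congrArg (fun J => powTorsion J (I.cocomplex.X (k + 2))) hI₂).le z.2.2
      obtain ⟨y', hy', h'⟩ := key.2 z.1 hz2 y hy hyz
      exact ⟨y', (congrArg (fun J => powTorsion J (I.cocomplex.X (k + 1))) hI₂).ge hy', h'⟩

end LocalCohomologyCech

end LocalCohomology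

section MaximalMinors

open Finset Submodule

theorem LinearIndepOn.exists_exchange {ι L V : Type*} [DecidableEq ι] [Field L] [AddCommGroup V]
    [Module L V] {r : ι → V} {B : Finset ι} (hB : LinearIndepOn L r (B : Set ι)) {w : ι}
    (hw : r w ∈ span L (r '' B)) {C : Set ι} (hC : r w ∉ span L (r '' C)) :
    ∃ b ∈ B, b ∉ C ∧ LinearIndepOn L r (insert w (B.erase b) : Finset ι) := by
  obtain ⟨c, hc, hcw⟩ := (Finsupp.mem_span_image_iff_linearCombination L).1 hw
  have hcB : (c.support : Set ι) ⊆ B := (Finsupp.mem_supported L c).1 hc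
  obtain ⟨b, hb, hbC⟩ : ∃ b ∈ c.support, b ∉ C := by
    by_contra! h
    exact hC ((Finsupp.mem_span_image_iff_linearCombination L).2
      ⟨c, (Finsupp.mem_supported L c).2 h, hcw⟩)
  have hins : insert b ((B.erase b : Finset ι) : Set ι) = B := by
    rw [← coe_insert, insert_erase (hcB hb)]
  have hb' : r b ∉ span L (r '' (B.erase b : Finset ι)) := by
    rw [← hins] at hB
    exact ((linearIndepOn_insert (by simp)).1 hB).2
  refine ⟨b, hcB hb, hbC, ?_⟩
  rw [coe_insert]
  refine (hB.mono (by simp)).insert fun hw' => hb' ?_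
  rw [Finsupp.linearCombination_apply, Finsupp.sum, ← add_sum_erase _ _ hb] at hcw
  have hrest : ∑ i ∈ c.support.erase b, c i • r i ∈ span L (r '' (B.erase b : Finset ι)) :=
    sum_mem fun i hi => smul_mem _ _ (subset_span ⟨i, by
      simpa using ⟨hcB (mem_erase.1 hi).2, (mem_erase.1 hi).1⟩, rfl⟩)
  have := sub_mem hw' hrest
  rw [← hcw, add_sub_cancel_right] at this
  exact (smul_mem_iff _ (Finsupp.mem_support_iff.1 hb)).1 this

variable {L : Type*} [Field L] {m n : ℕ}

theorem linearIndepOn_range_iff_det_ne_zero {M : Matrix (Fin m) (Fin n) L} {g : Fin n → Fin m}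
    (hg : StrictMono g) :
    LinearIndepOn L M.row (univ.image g : Finset (Fin m)) ↔ (M.submatrix g id).det ≠ 0 := by
  rw [coe_image, coe_univ, Set.image_univ, linearIndepOn_range_iff hg.injective,
    ← isUnit_iff_ne_zero, ← Matrix.isUnit_iff_isUnit_det, ← Matrix.linearIndependent_rows_iff_isUnit]
  rfl

theorem exists_strictMono_of_card {A : Finset (Fin m)} (hA : A.card = n) :
    ∃ g : Fin n → Fin m, StrictMono g ∧ univ.image g = A :=
  ⟨A.orderEmbOfFin hA, (A.orderEmbOfFin hA).strictMono, by
    apply coe_injective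
    rw [coe_image, coe_univ, Set.image_univ, range_orderEmbOfFin]⟩

theorem span_image_eq_top {M : Matrix (Fin m) (Fin n) L} {g : Fin n → Fin m}
    (h : (M.submatrix g id).det ≠ 0) :
    span L (M.row '' (univ.image g : Finset (Fin m))) = ⊤ := by
  rw [← isUnit_iff_ne_zero, ← Matrix.isUnit_iff_isUnit_det,
    ← Matrix.linearIndependent_rows_iff_isUnit] at h
  have := h.span_eq_top_of_card_eq_finrank' (by simp)
  rw [coe_image, coe_univ, Set.image_univ, ← Set.range_comp]
  exact this

/-- A nonzero row can be exchanged into a nonvanishing maximal minor, avoiding a set of rows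
that does not span it. -/
theorem exists_minor_ne_zero_of_exchange {M : Matrix (Fin m) (Fin n) L} {g : Fin n → Fin m}
    (hg : StrictMono g) (h : (M.submatrix g id).det ≠ 0) {x : Fin m} (hx : x ∉ Set.range g)
    {C : Set (Fin m)} (hC : M.row x ∉ span L (M.row '' C)) :
    ∃ b, b ∉ C ∧ b ∈ Set.range g ∧ ∃ g' : Fin n → Fin m, StrictMono g' ∧
      univ.image g' = insert x ((univ.image g).erase b) ∧ (M.submatrix g' id).det ≠ 0 := by
  obtain ⟨b, hb, hbC, hli⟩ := ((linearIndepOn_range_iff_det_ne_zero hg).2 h).exists_exchange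
    (w := x) (by rw [span_image_eq_top h]; trivial) hC
  have hcard : (insert x ((univ.image g).erase b)).card = n := by
    have hxi : x ∉ (univ.image g).erase b := by
      intro hx'
      have := mem_of_mem_erase hx'
      simp only [mem_image, mem_univ, true_and] at this
      exact hx this
    have hc : (univ.image g).card = n := by simp [card_image_of_injective _ hg.injective]
    have := card_erase_add_one hb
    rw [card_insert_of_notMem hxi]
    omega
  obtain ⟨g', hg', himg⟩ := exists_strictMono_of_card hcard
  refine ⟨b, hbC, by simpa using hb, g', hg', himg, ?_⟩
  rwa [← linearIndepOn_range_iff_det_ne_zero hg', himg]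

/-- The height of a maximal minor above the one using the first rows. -/
def minorLevel (g : Fin n → Fin m) : ℕ := ∑ j, ((g j : ℕ) - j)

theorem minorLevel_add {g : Fin n → Fin m} (hg : StrictMono g) :
    minorLevel g + ∑ j : Fin n, (j : ℕ) = ∑ i ∈ univ.image g, (i : ℕ) := by
  rw [minorLevel, ← sum_add_distrib, sum_image hg.injective.injOn]
  refine sum_congr rfl fun j _ => Nat.sub_add_cancel ?_
  have : ∀ k : ℕ, ∀ hk : k < n, k ≤ g ⟨k, hk⟩ := by
    intro k
    induction k with
    | zero => simp
    | succ k ih =>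
      intro hk
      have h1 := ih (by omega)
      have h2 : g ⟨k, by omega⟩ < g ⟨k + 1, hk⟩ := hg (by simp)
      have h3 : (g ⟨k, by omega⟩ : ℕ) < g ⟨k + 1, hk⟩ := h2
      omega
  exact this j j.2

/-- Two distinct nonvanishing maximal minors of the same level force a nonvanishing one of
smaller level. -/
theorem exists_minorLevel_lt {M : Matrix (Fin m) (Fin n) L} {g h : Fin n → Fin m}
    (hg : StrictMono g) (hh : StrictMono h) (hne : g ≠ h) (hgM : (M.submatrix g id).det ≠ 0)
    (hhM : (M.submatrix h id).det ≠ 0) (hl : minorLevel g = minorLevel h) :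
    ∃ g' : Fin n → Fin m, StrictMono g' ∧ minorLevel g' < minorLevel g ∧
      (M.submatrix g' id).det ≠ 0 := by
  have hcard : ∀ {g : Fin n → Fin m}, StrictMono g → (univ.image g).card = n := fun hg => by
    simp [card_image_of_injective _ hg.injective]
  have hAB : univ.image g ≠ univ.image h := by
    intro hAB
    have := congrArg (fun s : Finset (Fin m) => (s : Set (Fin m))) hAB
    simp only [coe_image, coe_univ, Set.image_univ] at this
    exact hne ((hg.range_inj hh).1 this)
  have hsd : (symmDiff (univ.image g) (univ.image h)).Nonempty :=
    nonempty_iff_ne_empty.2 fun h0 => hAB (symmDiff_eq_bot.1 h0)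
  wlog hx : (symmDiff (univ.image g) (univ.image h)).min' hsd ∈ univ.image g generalizing g h
  · have hsd' : (symmDiff (univ.image h) (univ.image g)).Nonempty := by rwa [symmDiff_comm]
    obtain ⟨g', h1, h2, h3⟩ := this hh hg hne.symm hhM hgM hl.symm hAB.symm hsd' (by
      have := min'_mem _ hsd
      simp only [symmDiff_comm (univ.image h)]
      rw [mem_symmDiff] at this
      tauto)
    exact ⟨g', h1, hl ▸ h2, h3⟩
  set x := (symmDiff (univ.image g) (univ.image h)).min' hsd with hxdef
  have hxs : x ∈ symmDiff (univ.image g) (univ.image h) := min'_mem _ _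
  have hxh : x ∉ univ.image h := by
    rw [mem_symmDiff] at hxs; tauto
  have hgli := (linearIndepOn_range_iff_det_ne_zero hg).2 hgM
  have hC : M.row x ∉ span L (M.row '' ((univ.image g).erase x : Finset (Fin m))) := by
    rw [← insert_erase hx, coe_insert, linearIndepOn_insert (by simp)] at hgli
    exact hgli.2
  obtain ⟨b, hbC, hb, g', hg', himg, hdet⟩ :=
    exists_minor_ne_zero_of_exchange hh hhM (by simpa using hxh) hC
  have hb' : b ∈ univ.image h := by simpa using hb
  have hbx : b ≠ x := fun e => hxh (e ▸ hb')
  have hbg : b ∉ univ.image g := fun hbg => hbC (by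
    rw [mem_coe]; exact mem_erase.2 ⟨hbx, hbg⟩)
  have hlt : x < b := lt_of_le_of_ne (min'_le _ _ (mem_symmDiff.2 (Or.inr ⟨hb', hbg⟩))) hbx.symm
  refine ⟨g', hg', ?_, hdet⟩
  have e1 := minorLevel_add hg'
  have e2 := minorLevel_add hh
  rw [himg, sum_insert (fun h' => hxh (mem_of_mem_erase h'))] at e1
  rw [← add_sum_erase _ _ hb'] at e2
  have : (x : ℕ) < b := hlt
  omega

section CommRing

variable {R : Type*} [CommRing R]

open scoped Classical in
/-- The sum of all maximal minors of a given level. -/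
noncomputable def levelSum (M : Matrix (Fin m) (Fin n) R) (l : ℕ) : R :=
  ∑ g : Fin n → Fin m with StrictMono g ∧ minorLevel g = l, (M.submatrix g id).det

theorem exists_ringHom_ker_eq (P : Ideal R) [P.IsPrime] :
    ∃ (φ : R →+* FractionRing (R ⧸ P)), ∀ a, φ a = 0 ↔ a ∈ P :=
  ⟨(algebraMap (R ⧸ P) _).comp (Ideal.Quotient.mk P), fun a => by
    rw [RingHom.comp_apply, FaithfulSMul.algebraMap_eq_zero_iff, Ideal.Quotient.eq_zero_iff_mem]⟩

theorem map_det_submatrix {R' : Type*} [CommRing R'] (φ : R →+* R') (M : Matrix (Fin m) (Fin n) R)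
    (g : Fin n → Fin m) :
    φ (M.submatrix g id).det = ((M.map φ).submatrix g id).det := by
  rw [RingHom.map_det]; rfl

/-- The sums of maximal minors of the lowest levels generate the same radical as the maximal
minors of these levels. -/
theorem det_submatrix_mem_of_levelSum_mem (M : Matrix (Fin m) (Fin n) R) (P : Ideal R)
    [P.IsPrime] (N : ℕ) (h : ∀ l < N, levelSum M l ∈ P) (g : Fin n → Fin m) (hg : StrictMono g)
    (hgN : minorLevel g < N) : (M.submatrix g id).det ∈ P := by
  classical
  obtain ⟨φ, hφ⟩ := exists_ringHom_ker_eq P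
  induction hl : minorLevel g using Nat.strong_induction_on generalizing g with
  | _ l ih =>
    subst hl
    by_contra hgP
    refine hgP ?_
    have hsum := h _ hgN
    rw [levelSum, ← add_sum_erase _ _ (by simpa using hg : g ∈ _)] at hsum
    refine (Ideal.add_mem_iff_left _ (sum_mem fun h' hh' => ?_)).1 hsum
    simp only [mem_erase, mem_filter, mem_univ, true_and] at hh'
    by_contra hh'P
    rw [← hφ, map_det_submatrix] at hgP hh'P
    obtain ⟨g', hg', hlt, hdet⟩ :=
      exists_minorLevel_lt hg hh'.2.1 hh'.1.symm hgP hh'P hh'.2.2.symm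
    rw [← map_det_submatrix] at hdet
    exact hdet ((hφ _).2 (ih _ hlt g' hg' (hlt.trans hgN) rfl))

theorem apply_mem_of_det_submatrix_mem (M : Matrix (Fin m) (Fin n) R) (P : Ideal R)
    [P.IsPrime] {h : Fin n → Fin m} (hh : StrictMono h) (hP : (M.submatrix h id).det ∉ P)
    {x : Fin m} (hx : x ∉ Set.range h)
    (H : ∀ g : Fin n → Fin m, StrictMono g → x ∈ Set.range g → (M.submatrix g id).det ∈ P)
    (j : Fin n) : M x j ∈ P := by
  obtain ⟨φ, hφ⟩ := exists_ringHom_ker_eq P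
  by_contra hj
  rw [← hφ, map_det_submatrix] at hP
  obtain ⟨b, -, -, g, hg, himg, hdet⟩ := exists_minor_ne_zero_of_exchange hh hP hx (C := ∅) (by
    simp only [Set.image_empty, span_empty, mem_bot]
    intro h0
    exact hj ((hφ _).1 (congrFun h0 j)))
  rw [← map_det_submatrix] at hdet
  refine hdet ((hφ _).2 (H g hg ?_))
  have : x ∈ univ.image g := himg ▸ mem_insert_self _ _
  simpa using this

variable {p q : ℕ}

/-- The last `q + 2` rows with one of them omitted. -/
def bottomRows (p : ℕ) {q : ℕ} (k : Fin (q + 2)) (j : Fin (q + 1)) : Fin (p + (q + 2)) :=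
  Fin.natAdd p (k.succAbove j)

theorem strictMono_bottomRows (k : Fin (q + 2)) : StrictMono (bottomRows p k) :=
  (Fin.strictMono_natAdd p).comp (Fin.strictMono_succAbove k)

theorem bottomRows_injective : Function.Injective (bottomRows p (q := q)) := by
  intro k k' h
  refine Fin.succAbove_left_injective (funext fun j => ?_)
  exact Fin.natAdd_injective _ _ (congrFun h j)

theorem castAdd_notMem_range_bottomRows (i : Fin p) (k : Fin (q + 2)) :
    Fin.castAdd (q + 2) i ∉ Set.range (bottomRows p k) := by
  rintro ⟨j, hj⟩
  have := congrArg Fin.val hj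
  simp only [bottomRows, Fin.val_natAdd, Fin.val_castAdd] at this
  omega

theorem minorLevel_bottomRows_zero : minorLevel (bottomRows p (0 : Fin (q + 2))) =
    (q + 1) * (p + 1) := by
  have : ∀ j : Fin (q + 1), ((bottomRows p (0 : Fin (q + 2)) j : ℕ) - j) = p + 1 := by
    intro j
    simp [bottomRows]
    omega
  simp [minorLevel, this]

theorem minorLevel_bottomRows (k : Fin (q + 2)) :
    minorLevel (bottomRows p k) + k = (q + 1) * (p + 1) := by
  have key : ∀ k : Fin (q + 2), minorLevel (bottomRows p k) + ∑ j : Fin (q + 1), (j : ℕ) + (p + k) =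
      ∑ k : Fin (q + 2), (p + k : ℕ) := by
    intro k
    rw [minorLevel_add (strictMono_bottomRows k), sum_image (strictMono_bottomRows k).injective.injOn,
      Fin.sum_univ_succAbove _ k, add_comm]
    simp [bottomRows]
  have h0 := key 0
  rw [← key k, minorLevel_bottomRows_zero] at h0
  simp at h0
  omega

theorem exists_eq_bottomRows {g : Fin (q + 1) → Fin (p + (q + 2))} (hg : StrictMono g)
    (h : ∀ j, p ≤ g j) : ∃ k, g = bottomRows p k := by
  have : ∀ j, ∃ k : Fin (q + 2), Fin.natAdd p k = g j := fun j =>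
    ⟨⟨g j - p, by omega⟩, by ext; simp [h j]⟩
  choose g' hg' using this
  have hmono : StrictMono g' := fun i j hij => by
    have := hg hij
    rwa [← hg', ← hg', Fin.natAdd_lt_natAdd_iff] at this
  have hcard : ((univ.image g')ᶜ).card = 1 := by
    rw [card_compl, card_image_of_injective _ hmono.injective]
    simp
  obtain ⟨k, hk⟩ := card_eq_one.1 hcard
  refine ⟨k, ?_⟩
  have : g' = k.succAbove := by
    refine (hmono.range_inj (Fin.strictMono_succAbove k)).1 ?_
    rw [Fin.range_succAbove, ← coe_singleton, ← hk, coe_compl, compl_compl, coe_image, coe_univ,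
      Set.image_univ]
  funext j
  rw [← hg', this]; rfl

theorem eq_bottomRows_of_le_minorLevel {g : Fin (q + 1) → Fin (p + (q + 2))} (hg : StrictMono g)
    (h : (q + 1) * p + q ≤ minorLevel g) : g = bottomRows p 0 ∨ g = bottomRows p 1 := by
  have hle : ∀ d, ∀ j : Fin (q + 1), j + d = q → g j + d ≤ p + q + 1 := by
    intro d
    induction d with
    | zero => intro j _; omega
    | succ d ih =>
      intro j hj
      have h1 := ih ⟨j + 1, by omega⟩ (by simp; omega)
      have h2 : (g j : ℕ) < g ⟨j + 1, by omega⟩ := hg (by rw [Fin.lt_def]; simp)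
      omega
  have h0 : p ≤ g 0 := by
    by_contra h0
    rw [minorLevel, Fin.sum_univ_succ] at h
    have : ∑ j : Fin q, ((g j.succ : ℕ) - j.succ) ≤ ∑ j : Fin q, (p + 1) :=
      sum_le_sum fun j _ => by
        have := hle (q - j.succ) j.succ (by simp)
        have := j.2
        simp at *
        omega
    simp at this h
    nlinarith
  obtain ⟨k, rfl⟩ := exists_eq_bottomRows hg fun j => h0.trans (hg.monotone (Fin.zero_le j))
  have := minorLevel_bottomRows (p := p) k
  have hk : (k : ℕ) ≤ 1 := by nlinarith
  interval_cases hk' : (k : ℕ)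
  · left; congr; ext; simpa using hk'
  · right; congr; ext; simpa using hk'

/-- The variables of the first rows and the maximal minors of the last `q + 2` rows. -/
noncomputable def bottomSystem (M : Matrix (Fin (p + (q + 2))) (Fin (q + 1)) R) :
    (Fin p × Fin (q + 1)) ⊕ Fin (q + 2) → R :=
  Sum.elim (fun v => M (Fin.castAdd _ v.1) v.2)
    (fun k => (-1) ^ (k : ℕ) * (M.submatrix (bottomRows p k) id).det)

theorem bottomSystem_inr_mem_iff (M : Matrix (Fin (p + (q + 2))) (Fin (q + 1)) R) (P : Ideal R)
    (k : Fin (q + 2)) :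
    bottomSystem M (Sum.inr k) ∈ P ↔ (M.submatrix (bottomRows p k) id).det ∈ P :=
  Ideal.unit_mul_mem_iff_mem _ ((isUnit_one.neg).pow _)

theorem levelSum_mem_span (M : Matrix (Fin (p + (q + 2))) (Fin (q + 1)) R) {l : ℕ}
    (hl : l < (q + 1) * p + q) {J : Ideal R} (h : ∀ i j, M (Fin.castAdd _ i) j ∈ J)
    (h' : ∀ k : Fin q, (M.submatrix (bottomRows p k.succ.succ) id).det ∈ J) :
    levelSum M l ∈ J := by
  classical
  refine sum_mem fun g hg => ?_
  simp only [mem_filter, mem_univ, true_and] at hg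
  obtain ⟨hg, rfl⟩ := hg
  by_cases h0 : p ≤ g 0
  · obtain ⟨k, rfl⟩ := exists_eq_bottomRows hg fun j => h0.trans (hg.monotone (Fin.zero_le j))
    have hk : 2 ≤ (k : ℕ) := by
      have := minorLevel_bottomRows (p := p) k
      nlinarith
    convert h' ⟨k - 2, by omega⟩
    ext
    simp
    omega
  · rw [Matrix.det_succ_row_zero]
    refine sum_mem fun j _ => Ideal.mul_mem_right _ _ (Ideal.mul_mem_left _ _ ?_)
    exact h ⟨g 0, by omega⟩ j

theorem det_submatrix_mem_of_prime (M : Matrix (Fin (p + (q + 2))) (Fin (q + 1)) R) (P : Ideal R)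
    [P.IsPrime] (h : ∀ l < (q + 1) * p + q, levelSum M l ∈ P)
    {g : Fin (q + 1) → Fin (p + (q + 2))} (hg : StrictMono g) (h0 : g ≠ bottomRows p 0)
    (h1 : g ≠ bottomRows p 1) : (M.submatrix g id).det ∈ P := by
  refine det_submatrix_mem_of_levelSum_mem M P _ h g hg (lt_of_not_ge fun hle => ?_)
  rcases eq_bottomRows_of_le_minorLevel hg hle with h | h
  exacts [h0 h, h1 h]

theorem bottomRows_ne {k k' : Fin (q + 2)} (h : k ≠ k') : bottomRows p k ≠ bottomRows p k' :=
  fun e => h (bottomRows_injective e)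

end CommRing

theorem nonempty_localCohomology_maximalMinors_equiv {R : Type} [CommRing R] [IsNoetherianRing R]
    {p q : ℕ} (M : Matrix (Fin (p + (q + 2))) (Fin (q + 1)) R) (I : Ideal R)
    (hI : I = Ideal.span {a | ∃ g : Fin (q + 1) → Fin (p + (q + 2)), StrictMono g ∧
      a = (M.submatrix g id).det}) :
    Nonempty ((localCohomology I ((q + 1) * p + q + 2)).obj (ModuleCat.of R R) ≃ₗ[R]
      (localCohomology (Ideal.span (Set.range (bottomSystem M))) ((q + 1) * p + q + 2)).obj
        (ModuleCat.of R R)) := by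
  let l : List R := (List.range ((q + 1) * p + q)).map (levelSum M)
  let l' : List R := (univ : Finset ((Fin p × Fin (q + 1)) ⊕ Fin q)).toList.map
    (bottomSystem M ∘ Sum.map id (Fin.succ ∘ Fin.succ))
  have hlP : ∀ {P : Ideal R}, Ideal.span {a | a ∈ l} ≤ P →
      ∀ i < (q + 1) * p + q, levelSum M i ∈ P := fun hP i hi =>
    hP (Ideal.subset_span (List.mem_map_of_mem (List.mem_range.2 hi)))
  have hl'v : ∀ v, (bottomSystem M ∘ Sum.map id (Fin.succ ∘ Fin.succ)) v ∈
      Ideal.span {a | a ∈ l'} := fun v =>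
    Ideal.subset_span (List.mem_map_of_mem (mem_toList.2 (mem_univ v)))
  have hIg : ∀ {P : Ideal R}, I ≤ P ↔ ∀ g : Fin (q + 1) → Fin (p + (q + 2)), StrictMono g →
      (M.submatrix g id).det ∈ P := by
    intro P
    rw [hI, Ideal.span_le]
    exact ⟨fun h g hg => h ⟨g, hg, rfl⟩, fun h _ ⟨g, hg, e⟩ => e ▸ h g hg⟩
  have hl'P : ∀ {P : Ideal R}, (∀ i j, M (Fin.castAdd _ i) j ∈ P) →
      (∀ k : Fin q, (M.submatrix (bottomRows p k.succ.succ) id).det ∈ P) →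
      Ideal.span {a | a ∈ l'} ≤ P := by
    intro P h1 h2
    rw [Ideal.span_le]
    rintro _ ha
    obtain ⟨v | k, -, rfl⟩ := List.mem_map.1 ha
    · exact h1 _ _
    · exact (bottomSystem_inr_mem_iff M P _).2 (h2 k)
  have hrow : ∀ {P : Ideal R} [P.IsPrime] (k : Fin (q + 2)),
      (∀ l < (q + 1) * p + q, levelSum M l ∈ P) →
      (M.submatrix (bottomRows p k) id).det ∉ P → ∀ i j, M (Fin.castAdd _ i) j ∈ P := by
    intro P _ k h hk i j
    refine apply_mem_of_det_submatrix_mem M P (strictMono_bottomRows k) hk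
      (castAdd_notMem_range_bottomRows i k) (fun g hg hx => ?_) j
    exact det_submatrix_mem_of_prime M P h hg
      (fun e => castAdd_notMem_range_bottomRows i 0 (e ▸ hx))
      (fun e => castAdd_notMem_range_bottomRows i 1 (e ▸ hx))
  have hbeta : ∀ {P : Ideal R} [P.IsPrime], (∀ l < (q + 1) * p + q, levelSum M l ∈ P) →
      ∀ k : Fin q, (M.submatrix (bottomRows p k.succ.succ) id).det ∈ P := by
    intro P _ h k
    refine det_submatrix_mem_of_prime M P h (strictMono_bottomRows _) (bottomRows_ne ?_)
      (bottomRows_ne ?_)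
    · exact Fin.succ_ne_zero _
    · rw [← Fin.succ_zero_eq_one, Ne, Fin.succ_inj]
      exact Fin.succ_ne_zero _
  have hlen : l'.length = (q + 1) * p + q := by simp [l']; ring
  refine localCohomology_equiv_of_torsion_comparison (l := l) (l' := l')
    (α := bottomSystem M (Sum.inr 1)) (δ := bottomSystem M (Sum.inr 0)) (by simp [l]) hlen.le
    ?_ ?_ ?_ ?_ ?_
  · rw [Ideal.span_le]
    rintro _ ha
    obtain ⟨i, hi, rfl⟩ := List.mem_map.1 ha
    refine levelSum_mem_span M (List.mem_range.1 hi) (fun i j => hl'v (Sum.inl (i, j)))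
      fun k => (bottomSystem_inr_mem_iff M _ _).1 (hl'v (Sum.inr k))
  · rw [Ideal.radical_eq_sInf]
    refine le_sInf fun P ⟨hP, hprime⟩ => hprime.mul_le.2 ?_
    rw [Ideal.span_singleton_le_iff_mem, or_iff_not_imp_left, bottomSystem_inr_mem_iff]
    exact fun h1 => hl'P (hrow 1 (hlP hP) h1) (hbeta (hlP hP))
  · rw [Ideal.radical_eq_sInf]
    refine le_sInf fun P ⟨hP, hprime⟩ => hprime.mul_le.2 ?_
    rw [Ideal.span_singleton_le_iff_mem, or_iff_not_imp_left, bottomSystem_inr_mem_iff]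
    have hP' := le_sup_left.trans hP
    exact fun h0 => sup_le (hl'P (hrow 0 (hlP hP') h0) (hbeta (hlP hP')))
      (le_sup_right.trans hP)
  · refine le_antisymm (Ideal.radical_le_radical_iff.2 ?_) (Ideal.radical_mono ?_)
    · rw [Ideal.radical_eq_sInf]
      refine le_sInf fun P ⟨hP, hprime⟩ => hIg.2 fun g hg => ?_
      simp only [sup_le_iff, Ideal.span_singleton_le_iff_mem, bottomSystem_inr_mem_iff] at hP
      by_cases h0 : g = bottomRows p 0
      · exact h0 ▸ hP.2
      by_cases h1 : g = bottomRows p 1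
      · exact h1 ▸ hP.1.2
      exact det_submatrix_mem_of_prime M P (hlP hP.1.1) hg h0 h1
    · simp only [sup_le_iff, Ideal.span_singleton_le_iff_mem, bottomSystem_inr_mem_iff]
      refine ⟨⟨?_, hIg.1 le_rfl _ (strictMono_bottomRows _)⟩,
        hIg.1 le_rfl _ (strictMono_bottomRows _)⟩
      rw [Ideal.span_le]
      rintro _ ha
      obtain ⟨i, hi, rfl⟩ := List.mem_map.1 ha
      refine sum_mem fun g hg => hIg.1 le_rfl g (mem_filter.1 hg).2.1
  · refine le_antisymm ?_ (sup_le (sup_le ?_ ?_) ?_)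
    · rw [Ideal.span_le]
      rintro _ ⟨v | k, rfl⟩
      · exact Ideal.mem_sup_left (Ideal.mem_sup_left (hl'v (Sum.inl v)))
      · refine Fin.cases ?_ (fun k => Fin.cases ?_ (fun k => ?_) k) k
        · exact Ideal.mem_sup_right (Ideal.mem_span_singleton_self _)
        · exact Ideal.mem_sup_left (Ideal.mem_sup_right (Ideal.mem_span_singleton_self _))
        · exact Ideal.mem_sup_left (Ideal.mem_sup_left (hl'v (Sum.inr k)))
    · rw [Ideal.span_le]
      rintro _ ha
      obtain ⟨v, -, rfl⟩ := List.mem_map.1 ha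
      exact Ideal.subset_span ⟨_, rfl⟩
    · exact Ideal.span_mono (by rintro _ rfl; exact ⟨_, rfl⟩)
    · exact Ideal.span_mono (by rintro _ rfl; exact ⟨_, rfl⟩)

end MaximalMinors

section Cayley

open Matrix Finset

theorem Matrix.det_updateRow_zero_updateRow_succ {A : Type*} [CommRing A] {r : ℕ}
    (N : Matrix (Fin (r + 1)) (Fin (r + 1)) A) (α β : Fin (r + 1) → A) (i : Fin r) :
    ((N.updateRow 0 α).updateRow i.succ β).det = ∑ b : Fin (r + 1), (-1) ^ (b : ℕ) * α b *
      ((N.submatrix Fin.succ b.succAbove).updateRow i (β ∘ b.succAbove)).det := by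
  rw [det_succ_row_zero]
  refine sum_congr rfl fun b _ => ?_
  rw [updateRow_ne (Fin.succ_ne_zero i).symm, updateRow_self]
  congr 2
  ext k l
  by_cases hk : k = i
  · subst hk; simp
  · simp [updateRow_ne hk, updateRow_ne (Fin.succ_injective _ |>.ne hk)]

theorem Derivation.apply_det {K A : Type*} [CommRing K] [CommRing A] [Algebra K A]
    (D : Derivation K A A) {r : ℕ} (N : Matrix (Fin r) (Fin r) A) :
    D N.det = ∑ i, (N.updateRow i fun j => D (N i j)).det := by
  induction r with
  | zero => simp
  | succ r ih =>
    rw [Fin.sum_univ_succ, det_succ_row_zero N, map_sum]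
    have h1 : ∀ i : Fin r, (N.updateRow i.succ fun j => D (N i.succ j)).det =
        ∑ b : Fin (r + 1), (-1) ^ (b : ℕ) * N 0 b * ((N.submatrix Fin.succ b.succAbove).updateRow i
          fun j => D (N.submatrix Fin.succ b.succAbove i j)).det := fun i => by
      have := det_updateRow_zero_updateRow_succ N (N 0) (fun j => D (N i.succ j)) i
      rw [updateRow_eq_self] at this
      exact this
    have h2 : (N.updateRow 0 fun j => D (N 0 j)).det = ∑ b : Fin (r + 1), (-1) ^ (b : ℕ) *
        D (N 0 b) * (N.submatrix Fin.succ b.succAbove).det := by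
      rw [det_succ_row_zero]
      refine sum_congr rfl fun b _ => ?_
      rw [updateRow_self]
      congr 2
    rw [sum_congr rfl fun i _ => h1 i, sum_comm, h2, ← sum_add_distrib]
    refine sum_congr rfl fun b _ => ?_
    have h3 : D ((-1 : A) ^ (b : ℕ)) = 0 := by
      rw [D.leibniz_pow]; simp
    rw [D.leibniz, D.leibniz, h3, ih, smul_eq_mul, smul_eq_mul, smul_eq_mul, smul_eq_mul, mul_zero,
      add_zero, mul_sum, mul_comm _ ((-1) ^ (b : ℕ) * D (N 0 b)), add_comm]

theorem Matrix.sum_det_updateRow_of_bilinear {A κ : Type*} [CommRing A] [Fintype κ] {r : ℕ}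
    (N : Matrix (Fin (r + 1)) (Fin (r + 1)) A) (c : κ → A) (γ : κ → Fin (r + 1) → A) (i : Fin r) :
    ∑ b : Fin (r + 1), (-1) ^ (b : ℕ) * ((N.submatrix Fin.succ b.succAbove).updateRow i
      fun j => -(N i.succ b * N 0 (b.succAbove j)) +
        ∑ k, c k * γ k b * γ k (b.succAbove j)).det = N.det := by
  have key : ∀ b : Fin (r + 1), ((N.submatrix Fin.succ b.succAbove).updateRow i
      fun j => -(N i.succ b * N 0 (b.succAbove j)) +
        ∑ k, c k * γ k b * γ k (b.succAbove j)).det =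
      -(N i.succ b * ((N.submatrix Fin.succ b.succAbove).updateRow i (N 0 ∘ b.succAbove)).det) +
      ∑ k, c k * γ k b *
        ((N.submatrix Fin.succ b.succAbove).updateRow i (γ k ∘ b.succAbove)).det := by
    intro b
    have e : (fun j => -(N i.succ b * N 0 (b.succAbove j)) +
        ∑ k, c k * γ k b * γ k (b.succAbove j)) = (-N i.succ b) • (N 0 ∘ b.succAbove) +
        ∑ k, (c k * γ k b) • (γ k ∘ b.succAbove) := by
      ext j
      simp
    have hsum : ∀ v : κ → Fin r → A, ((N.submatrix Fin.succ b.succAbove).updateRow i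
        (∑ k, v k)).det = ∑ k, ((N.submatrix Fin.succ b.succAbove).updateRow i (v k)).det :=
      fun v => (detRowAlternating (R := A)).toMultilinearMap.map_update_sum univ i v _
    rw [e, det_updateRow_add, det_updateRow_smul, hsum]
    simp only [det_updateRow_smul, neg_mul]
  have e1 := det_updateRow_zero_updateRow_succ N (N i.succ) (N 0) i
  have e2 : ∀ k, ∑ b : Fin (r + 1), (-1) ^ (b : ℕ) * γ k b *
      ((N.submatrix Fin.succ b.succAbove).updateRow i (γ k ∘ b.succAbove)).det = 0 := fun k => by
    rw [← det_updateRow_zero_updateRow_succ N (γ k) (γ k) i]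
    refine det_zero_of_row_eq (Fin.succ_ne_zero i).symm ?_
    rw [updateRow_ne (Fin.succ_ne_zero i).symm, updateRow_self, updateRow_self]
  have e3 : ((N.updateRow 0 (N i.succ)).updateRow i.succ (N 0)).det = -N.det := by
    have : (N.updateRow 0 (N i.succ)).updateRow i.succ (N 0) =
        N.submatrix (Equiv.swap 0 i.succ) id := by
      ext k l
      by_cases hk : k = i.succ
      · subst hk; simp
      · by_cases hk0 : k = 0
        · subst hk0; simp [updateRow_ne hk]
        · simp [updateRow_ne hk, updateRow_ne hk0, Equiv.swap_apply_of_ne_of_ne hk0 hk]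
    rw [this, det_permute, Equiv.Perm.sign_swap (Fin.succ_ne_zero i).symm]
    simp
  calc _ = -(∑ b : Fin (r + 1), (-1) ^ (b : ℕ) * N i.succ b *
          ((N.submatrix Fin.succ b.succAbove).updateRow i (N 0 ∘ b.succAbove)).det) +
        ∑ k, c k * ∑ b : Fin (r + 1), (-1) ^ (b : ℕ) * γ k b *
          ((N.submatrix Fin.succ b.succAbove).updateRow i (γ k ∘ b.succAbove)).det := by
        simp only [mul_sum]
        rw [sum_comm, ← sum_neg_distrib, ← sum_add_distrib]
        refine sum_congr rfl fun b _ => ?_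
        rw [key, mul_add, mul_sum]
        congr 1
        · ring
        · exact sum_congr rfl fun k _ => by ring
    _ = N.det := by
        rw [← e1, e3]
        simp [e2]

/-- Iterated form of Cayley's identity for determinants of commuting derivations. -/
theorem cayley_det_submatrix {K L P ι κ : Type*} [CommRing K] [CommRing L] [Algebra K L]
    [CommRing P] [Algebra K P] [Fintype ι] (Φ : P →ₐ[K] Module.End K L) (Y : Matrix ι κ P)
    (D : ι → κ → Derivation K L L) (hΦ : ∀ a j x, Φ (Y a j) x = D a j x) (G : L) (σ : K)
    (E : Matrix ι κ L) (hG : ∀ a j, D a j G = σ • (G * E a j)) (c : ι → ι → ι → L)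
    (hE : ∀ a j i l, D a j (E i l) = -(E i j * E a l) + ∑ k, c a i k * E k j * E k l)
    {r : ℕ} (a : Fin r → ι) (J : Fin r → κ) :
    Φ (Y.submatrix a J).det G = (∏ i ∈ range r, (σ + i)) • (G * (E.submatrix a J).det) := by
  induction r with
  | zero => simp
  | succ r ih =>
    have hstep : ∀ b : Fin (r + 1), Φ ((-1) ^ (b : ℕ) * Y (a 0) (J b) *
        ((Y.submatrix a J).submatrix Fin.succ b.succAbove).det) G =
        (∏ i ∈ range r, (σ + i)) • ((-1) ^ (b : ℕ) * D (a 0) (J b)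
          (G * ((E.submatrix a J).submatrix Fin.succ b.succAbove).det)) := by
      intro b
      have := ih (a ∘ Fin.succ) (J ∘ b.succAbove)
      rw [map_mul, map_mul, map_pow, map_neg, map_one, Module.End.mul_apply, submatrix_submatrix,
        this, map_smul, Module.End.mul_apply, hΦ, ← submatrix_submatrix]
      congr 1
      rcases neg_one_pow_eq_or ℤ (b : ℕ) with h | h
      · have h1 : (-1 : Module.End K L) ^ (b : ℕ) = 1 := by exact_mod_cast congr(($h : Module.End K L))
        have h2 : (-1 : L) ^ (b : ℕ) = 1 := by exact_mod_cast congr(($h : L))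
        rw [h1, h2, Module.End.one_apply, one_mul]
      · have h1 : (-1 : Module.End K L) ^ (b : ℕ) = -1 := by exact_mod_cast congr(($h : Module.End K L))
        have h2 : (-1 : L) ^ (b : ℕ) = -1 := by exact_mod_cast congr(($h : L))
        rw [h1, h2, LinearMap.neg_apply, Module.End.one_apply, neg_one_mul]
    set N := E.submatrix a J with hN
    have hD : ∀ b : Fin (r + 1), (-1) ^ (b : ℕ) * D (a 0) (J b)
        (G * (N.submatrix Fin.succ b.succAbove).det) =
        σ • (G * ((-1) ^ (b : ℕ) * N 0 b * (N.submatrix Fin.succ b.succAbove).det)) +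
        ∑ i : Fin r, G * ((-1) ^ (b : ℕ) * ((N.submatrix Fin.succ b.succAbove).updateRow i
          fun j => -(N i.succ b * N 0 (b.succAbove j)) +
            ∑ k, c (a 0) (a i.succ) k * E k (J b) * E k (J (b.succAbove j))).det) := by
      intro b
      rw [Derivation.leibniz, Derivation.apply_det, hG]
      have : ∀ i : Fin r, (fun j => D (a 0) (J b) (N.submatrix Fin.succ b.succAbove i j)) =
          fun j => -(N i.succ b * N 0 (b.succAbove j)) +
            ∑ k, c (a 0) (a i.succ) k * E k (J b) * E k (J (b.succAbove j)) := fun i => by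
        ext j
        exact hE _ _ _ _
      simp only [this, ← mul_sum, smul_eq_mul, mul_add, Algebra.mul_smul_comm]
      rw [add_comm]
      congr 1
      · congr 1
        simp only [hN, submatrix_apply]
        ring
      · ring
    rw [det_succ_row_zero, map_sum, LinearMap.sum_apply]
    simp only [submatrix_apply]
    rw [sum_congr rfl fun b _ => hstep b, ← smul_sum, sum_congr rfl fun b _ => hD b,
      sum_add_distrib, sum_comm, ← smul_sum, ← mul_sum]
    have : ∀ i : Fin r, ∑ b : Fin (r + 1), G * ((-1) ^ (b : ℕ) *
        ((N.submatrix Fin.succ b.succAbove).updateRow i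
          fun j => -(N i.succ b * N 0 (b.succAbove j)) +
            ∑ k, c (a 0) (a i.succ) k * E k (J b) * E k (J (b.succAbove j))).det) = G * N.det :=
      fun i => by
        rw [← mul_sum, sum_det_updateRow_of_bilinear N (c (a 0) (a i.succ))
          (fun k b => E k (J b)) i]
    rw [sum_congr rfl fun i _ => this i, ← det_succ_row_zero, prod_range_succ, mul_smul, add_smul]
    simp [Nat.cast_smul_eq_nsmul]

/-- Cayley's identity for a product of powers of the signed maximal minors of a generic
`(n + 1) × n` matrix, given through its logarithmic derivatives. -/
theorem cayley_signed_minor {K L P : Type*} [Field K] [Field L] [Algebra K L]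
    [CommRing P] [Algebra K P] (Φ : P →ₐ[K] Module.End K L) {n : ℕ}
    (Y : Matrix (Fin (n + 1)) (Fin n) P) (D : Fin (n + 1) → Fin n → Derivation K L L)
    (hΦ : ∀ a j y, Φ (Y a j) y = D a j y) (x : Matrix (Fin (n + 1)) (Fin n) L)
    (hD : ∀ a j b l, D a j (x b l) = if a = b ∧ j = l then 1 else 0) (Δ : Fin (n + 1) → L)
    (hΔ : ∀ k, Δ k = (-1) ^ (k : ℕ) * (x.submatrix k.succAbove id).det) (hΔ0 : ∀ k, Δ k ≠ 0)
    (s : Fin (n + 1) → K) (hs : ∑ k, s k ≠ 0) (G : L)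
    (hG : ∀ a j, D a j G = (∑ k, s k • (D a j (Δ k) * (Δ k)⁻¹)) * G) (k : Fin (n + 1)) :
    Φ ((-1) ^ (k : ℕ) * (Y.submatrix k.succAbove id).det) G =
      (s k * (∑ k, s k)⁻¹ * ∏ i ∈ range n, (∑ k, s k + i)) • (G * (Δ k)⁻¹) := by
  set s' : Fin (n + 1) → L := fun k => algebraMap K L (s k) with hs'
  set σ : L := algebraMap K L (∑ k, s k) with hσ
  have hσ0 : σ ≠ 0 := by rwa [hσ, Ne, FaithfulSMul.algebraMap_eq_zero_iff]
  have hσs : ∑ k, s' k = σ := (map_sum _ _ _).symm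
  set u : Fin (n + 1) → L := fun k => s' k * (Δ k)⁻¹ with hu
  let Z : Matrix (Fin (n + 1)) (Fin (n + 1)) L := of fun k => Fin.cons (u k) (x k)
  have hZ0 : ∀ k, Z k 0 = u k := fun k => rfl
  have hZs : ∀ k l, Z k (Fin.succ l) = x k l := fun k l => rfl
  have hlap : ∀ v : Fin (n + 1) → L,
      (of fun k => (Fin.cons (v k) (x k) : Fin (n + 1) → L)).det = ∑ k, v k * Δ k := by
    intro v
    rw [det_succ_column_zero]
    refine sum_congr rfl fun k _ => ?_
    rw [hΔ]
    have : (of fun k => (Fin.cons (v k) (x k) : Fin (n + 1) → L)).submatrix k.succAbove Fin.succ =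
      x.submatrix k.succAbove id := rfl
    rw [this]
    change _ * v k * _ = _
    ring
  have hdet : Z.det = σ := by
    rw [hlap, ← hσs]
    exact sum_congr rfl fun k _ => inv_mul_cancel_right₀ (hΔ0 k) _
  have hunit : IsUnit Z.det := by rw [hdet]; exact isUnit_iff_ne_zero.2 hσ0
  have hΔx : ∀ l, ∑ k, x k l * Δ k = 0 := fun l => by
    rw [← hlap]
    exact det_zero_of_column_eq (Fin.succ_ne_zero l).symm fun k => rfl
  set E : Matrix (Fin (n + 1)) (Fin n) L := fun a j => Z⁻¹ j.succ a with hE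
  have hEx : ∀ j l, ∑ a, E a j * x a l = if j = l then 1 else 0 := fun j l => by
    have := congr_fun₂ (nonsing_inv_mul Z hunit) j.succ l.succ
    rw [mul_apply, one_apply] at this
    simp only [Fin.succ_inj] at this
    exact this
  have hEu : ∀ j, ∑ a, E a j * u a = 0 := fun j => by
    have := congr_fun₂ (nonsing_inv_mul Z hunit) j.succ 0
    rwa [mul_apply, one_apply, if_neg (Fin.succ_ne_zero j)] at this
  have hexp : ∀ (V : Fin (n + 1) → L) k, V k =
      (∑ i, V i * u i) * Z⁻¹ 0 k + ∑ l, (∑ i, V i * x i l) * E k l := fun V k => by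
    have h1 : V ᵥ* Z ᵥ* Z⁻¹ = V := by rw [vecMul_vecMul, mul_nonsing_inv Z hunit, vecMul_one]
    have h2 := (congr_fun h1 k).symm
    rw [vecMul, dotProduct, Fin.sum_univ_succ] at h2
    exact h2
  have hZinv : ∀ k, Z⁻¹ 0 k = Δ k * σ⁻¹ := fun k => by
    have := hexp Δ k
    have h1 : ∑ i, Δ i * u i = σ := by
      rw [← hσs]
      exact sum_congr rfl fun k _ => by rw [hu]; field_simp [hΔ0 k]
    have h2 : ∀ l, ∑ i, Δ i * x i l = 0 := fun l => by
      rw [← hΔx l]; exact sum_congr rfl fun _ _ => mul_comm _ _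
    simp only [h1, h2, zero_mul, sum_const_zero, add_zero] at this
    rw [this]
    field_simp
  have hDx : ∀ (V : Fin (n + 1) → L) a j l, ∑ i, V i * D a j (x i l) = if j = l then V a else 0 := by
    intro V a j l
    simp only [hD, ite_and]
    simp
  have hDs : ∀ a j k, D a j (s' k) = 0 := fun a j k => Derivation.map_algebraMap _ _
  have hDΔ : ∀ a j k, D a j (Δ k) = E a j * Δ k - E k j * Δ a := by
    intro a j
    set V : Fin (n + 1) → L := fun k => D a j (Δ k) + E k j * Δ a with hV
    have hVx : ∀ l, ∑ i, V i * x i l = 0 := fun l => by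
      have h1 := congrArg (D a j) (hΔx l)
      simp only [map_sum, Derivation.leibniz, smul_eq_mul, map_zero, sum_add_distrib] at h1
      rw [hDx] at h1
      simp only [hV, add_mul, sum_add_distrib]
      have h2 : ∑ i, E i j * Δ a * x i l = Δ a * if j = l then 1 else 0 := by
        rw [← hEx, mul_sum]; exact sum_congr rfl fun _ _ => by ring
      rw [h2]
      have h3 : ∑ i, D a j (Δ i) * x i l = ∑ i, x i l * D a j (Δ i) :=
        sum_congr rfl fun _ _ => mul_comm _ _
      rw [h3]
      split_ifs at h1 ⊢ <;> linear_combination h1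
    have hVk : ∀ k, V k = (∑ i, V i * u i) * (Δ k * σ⁻¹) := fun k => by
      have := hexp V k
      simpa only [hVx, zero_mul, sum_const_zero, add_zero, hZinv] using this
    have hDa : D a j (Δ a) = 0 := by
      rw [hΔ, Derivation.leibniz, Derivation.apply_det, Derivation.leibniz_pow]
      have : ∀ i : Fin n, ((x.submatrix a.succAbove id).updateRow i
          fun l => D a j (x.submatrix a.succAbove id i l)).det = 0 := fun i =>
        det_eq_zero_of_row_eq_zero i fun l => by
          rw [updateRow_self, submatrix_apply, hD, if_neg]
          exact fun h => Fin.succAbove_ne a i h.1.symm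
      rw [sum_eq_zero fun i _ => this i]
      simp
    have hτ := hVk a
    have hVa : V a = E a j * Δ a := by simp [hV, hDa]
    rw [hVa] at hτ
    have hτ' : E a j = (∑ i, V i * u i) * σ⁻¹ := by
      apply mul_right_cancel₀ (hΔ0 a)
      rw [hτ]; ring
    intro k
    have := hVk k
    rw [hτ']
    linear_combination this
  have hDG : ∀ a j, D a j G = (∑ k, s k) • (G * E a j) := by
    intro a j
    rw [hG, Algebra.smul_def, ← hσ, ← hσs]
    have : ∑ k, s k • (D a j (Δ k) * (Δ k)⁻¹) = (∑ k, s' k) * E a j - Δ a * ∑ k, E k j * u k := by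
      rw [sum_mul, mul_sum, ← sum_sub_distrib]
      refine sum_congr rfl fun k _ => ?_
      rw [hDΔ, Algebra.smul_def]
      have := hΔ0 k
      simp only [hu, hs']
      field_simp
    rw [this, hEu]
    ring
  have hDE : ∀ a j i l, D a j (E i l) = -(E i j * E a l) +
      ∑ k, (-(Δ a * Δ i * σ⁻¹ * (u k * (Δ k)⁻¹))) * E k j * E k l := by
    intro a j i l
    have hVx : ∀ l', ∑ i, D a j (E i l) * x i l' = -(if j = l' then E a l else 0) := fun l' => by
      have h1 := congrArg (D a j) (hEx l l')
      simp only [map_sum, Derivation.leibniz, smul_eq_mul, sum_add_distrib] at h1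
      rw [hDx] at h1
      have h2 : D a j (if l = l' then (1 : L) else 0) = 0 := by split_ifs <;> simp
      rw [h2] at h1
      have h3 : ∑ i, D a j (E i l) * x i l' = ∑ i, x i l' * D a j (E i l) :=
        sum_congr rfl fun _ _ => mul_comm _ _
      rw [h3]
      split_ifs at h1 ⊢ <;> linear_combination h1
    have hDu : ∀ i, D a j (u i) = -(u i * E a j) + u i * (Δ i)⁻¹ * E i j * Δ a := fun i => by
      have := hΔ0 i
      simp only [hu, Derivation.leibniz, hDs, Derivation.leibniz_inv, hDΔ, smul_eq_mul]
      field_simp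
      ring
    have hVu : ∑ i, D a j (E i l) * u i = -(Δ a * ∑ i, u i * (Δ i)⁻¹ * E i j * E i l) := by
      have h1 := congrArg (D a j) (hEu l)
      simp only [map_sum, Derivation.leibniz, smul_eq_mul, sum_add_distrib, map_zero] at h1
      have h2 : ∑ i, E i l * D a j (u i) = -(E a j * ∑ i, E i l * u i) +
          Δ a * ∑ i, u i * (Δ i)⁻¹ * E i j * E i l := by
        rw [mul_sum, mul_sum, ← sum_neg_distrib, ← sum_add_distrib]
        exact sum_congr rfl fun i _ => by rw [hDu]; ring
      rw [h2, hEu, mul_zero, neg_zero, zero_add] at h1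
      rw [eq_neg_iff_add_eq_zero, add_comm, ← h1]
      congr 1
      exact sum_congr rfl fun _ _ => mul_comm _ _
    have := hexp (fun i => D a j (E i l)) i
    rw [hVu, hZinv] at this
    simp only [hVx] at this
    rw [this, add_comm]
    congr 1
    · simp [mul_comm]
    · rw [neg_mul, mul_sum, sum_mul, ← sum_neg_distrib]
      exact sum_congr rfl fun k _ => by ring
  have hcay := cayley_det_submatrix Φ Y D hΦ G (∑ k, s k) E hDG _ hDE k.succAbove id
  have hminor : (E.submatrix k.succAbove id).det = (-1) ^ (k : ℕ) * (u k * σ⁻¹) := by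
    have h1 : adjugate Z⁻¹ = (Z⁻¹).det • Z := by
      calc adjugate Z⁻¹ = adjugate Z⁻¹ * (Z⁻¹ * Z) := by rw [nonsing_inv_mul Z hunit, mul_one]
        _ = _ := by rw [← mul_assoc, adjugate_mul, smul_mul_assoc, one_mul]
    have h2 := congr_fun₂ h1 k 0
    rw [adjugate_fin_succ_eq_det_submatrix, Matrix.smul_apply, hZ0, det_nonsing_inv, hdet,
      Ring.inverse_eq_inv', ← det_transpose] at h2
    have h3 : ((Z⁻¹).submatrix (Fin.succAbove 0) k.succAbove)ᵀ = E.submatrix k.succAbove id := by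
      ext i j
      simp only [hE, transpose_apply, submatrix_apply, Fin.succAbove_zero]
      rfl
    rw [h3] at h2
    have h4 : ((-1 : L) ^ (k : ℕ)) * (-1) ^ (k : ℕ) = 1 := by
      rw [← mul_pow]; simp
    simp only [Fin.val_zero, zero_add, smul_eq_mul] at h2
    rw [mul_comm (u k), ← h2, ← mul_assoc, h4, one_mul]
  rw [map_mul, Module.End.mul_apply, hcay, hminor, map_smul, map_pow, map_neg, map_one]
  have h5 : ∀ y : L, ((-1 : Module.End K L) ^ (k : ℕ)) y = (-1) ^ (k : ℕ) * y := by
    intro y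
    rcases neg_one_pow_eq_or ℤ (k : ℕ) with h | h
    · have h1 : (-1 : Module.End K L) ^ (k : ℕ) = 1 := by exact_mod_cast congr(($h : Module.End K L))
      have h2 : (-1 : L) ^ (k : ℕ) = 1 := by exact_mod_cast congr(($h : L))
      rw [h1, h2, Module.End.one_apply, one_mul]
    · have h1 : (-1 : Module.End K L) ^ (k : ℕ) = -1 := by exact_mod_cast congr(($h : Module.End K L))
      have h2 : (-1 : L) ^ (k : ℕ) = -1 := by exact_mod_cast congr(($h : L))
      rw [h1, h2, LinearMap.neg_apply, Module.End.one_apply, neg_one_mul]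
  have h4 : ((-1 : L) ^ (k : ℕ)) * (-1) ^ (k : ℕ) = 1 := by
    rw [← mul_pow]; simp
  rw [h5, Algebra.smul_def, Algebra.smul_def, map_mul, map_mul, map_inv₀, ← hσ]
  simp only [hu, hs']
  linear_combination (algebraMap K L (∏ i ∈ range n, (∑ k, s k + i))) * G * algebraMap K L (s k) *
    (Δ k)⁻¹ * σ⁻¹ * h4

end Cayley

section PolynomialActionOnFractions

open MvPolynomial

theorem Derivation.exists_extension_fractionRing {K S L : Type*} [Field K] [CommRing S] [IsDomain S]
    [Algebra K S] [Field L] [Algebra S L] [IsFractionRing S L] [Algebra K L] [IsScalarTower K S L]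
    (d : Derivation K S S) :
    ∃ D : Derivation K L L, ∀ s, D (algebraMap S L s) = algebraMap S L (d s) := by
  have := Algebra.FormallyEtale.of_isLocalization (Rₘ := L) (nonZeroDivisors S)
  have hbc := KaehlerDifferential.isBaseChange_of_formallyEtale K S L
  let f : Ω[S⁄K] →ₗ[S] L := Algebra.linearMap S L ∘ₗ d.liftKaehlerDifferential
  refine ⟨(hbc.lift f).compDer (KaehlerDifferential.D K L), fun s => ?_⟩
  have h := hbc.lift_eq f (KaehlerDifferential.D K S s)
  rw [KaehlerDifferential.map_D] at h
  simpa [f] using h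

theorem Derivation.eq_of_eq_algebraMap {K S L : Type*} [Field K] [CommRing S] [IsDomain S]
    [Algebra K S] [Field L] [Algebra S L] [IsFractionRing S L] [Algebra K L]
    {D D' : Derivation K L L} (h : ∀ s : S, D (algebraMap S L s) = D' (algebraMap S L s)) :
    D = D' := by
  ext y
  obtain ⟨a, b, hb, rfl⟩ := IsFractionRing.div_surjective (A := S) y
  rw [div_eq_mul_inv]
  simp only [Derivation.leibniz, Derivation.leibniz_inv, h]

open scoped IsMulCommutative in
/-- The action of a polynomial ring on its fraction field by constant coefficient differential
operators. -/
theorem exists_constantCoeff_action {K σ L : Type*} [Field K] [Field L] [Algebra (MvPolynomial σ K) L]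
    [IsFractionRing (MvPolynomial σ K) L] [Algebra K L] [IsScalarTower K (MvPolynomial σ K) L] :
    ∃ (D : σ → Derivation K L L) (Φ : MvPolynomial σ K →ₐ[K] Module.End K L),
      (∀ v p, D v (algebraMap (MvPolynomial σ K) L p) = algebraMap _ L (pderiv v p)) ∧
      ∀ v y, Φ (X v) y = D v y := by
  choose D hD using fun v : σ => Derivation.exists_extension_fractionRing (L := L)
    (pderiv (R := K) v)
  let E : σ → Module.End K L := fun v => (D v).toLinearMap
  have hcomm : ∀ v w y, D v (D w y) = D w (D v y) := fun v w y => by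
    classical
    rw [← sub_eq_zero, ← Derivation.commutator_apply]
    have : ⁅D v, D w⁆ = 0 := Derivation.eq_of_eq_algebraMap (S := MvPolynomial σ K) fun s => by
      rw [Derivation.commutator_apply, hD, hD, hD, hD, ← map_sub, ← Derivation.commutator_apply]
      have : ⁅(pderiv v : Derivation K (MvPolynomial σ K) (MvPolynomial σ K)),
          (pderiv w : Derivation K (MvPolynomial σ K) (MvPolynomial σ K))⁆ = 0 := by
        refine derivation_ext fun i => ?_
        simp [Derivation.commutator_apply, pderiv_X, Pi.single_apply, apply_ite]
      rw [this]; simp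
    rw [this]; rfl
  have hE : ∀ a ∈ Set.range E, ∀ b ∈ Set.range E, a * b = b * a := by
    rintro _ ⟨v, rfl⟩ _ ⟨w, rfl⟩
    exact LinearMap.ext (hcomm v w)
  have := Algebra.isMulCommutative_adjoin K hE
  refine ⟨D, (Algebra.adjoin K (Set.range E)).val.comp
    (aeval fun v => ⟨E v, Algebra.subset_adjoin ⟨v, rfl⟩⟩), hD, fun v y => ?_⟩
  rw [AlgHom.comp_apply, aeval_X]
  rfl

end PolynomialActionOnFractions

section CayleySystem

open MvPolynomial Finset

theorem MvPolynomial.eq_zero_of_pderiv_closed {K σ : Type*} [Field K] [CharZero K]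
    {N : MvPolynomial σ K → Prop} (hN : ∀ p v, N p → N (pderiv v p)) (hC : ∀ a, N (C a) → a = 0)
    {p : MvPolynomial σ K} (hp : N p) : p = 0 := by
  have key : ∀ d, ∀ p : MvPolynomial σ K, N p → (∀ m, d ≤ m.degree → p.coeff m = 0) → p = 0 := by
    intro d
    induction d with
    | zero => exact fun p _ h => MvPolynomial.ext _ _ fun m => h m (Nat.zero_le _)
    | succ d ih =>
      intro p hp h
      have hd : ∀ v, pderiv v p = 0 := fun v => by
        refine ih _ (hN _ v hp) fun m hm => ?_
        rw [coeff_pderiv, h _ (by simpa using hm), zero_mul]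
      have hpC : p = C (p.coeff 0) := by
        ext m
        classical
        rw [coeff_C]
        split_ifs with hm
        · rw [hm]
        · obtain ⟨v, hv⟩ := Finsupp.ne_iff.1 (Ne.symm hm)
          have hm' : m - Finsupp.single v 1 + Finsupp.single v 1 = m :=
            tsub_add_cancel_of_le (by simpa [Nat.one_le_iff_ne_zero] using hv)
          have := coeff_pderiv (i := v) p (m - Finsupp.single v 1)
          rw [hd, coeff_zero, hm', eq_comm, mul_eq_zero] at this
          exact this.resolve_right (by norm_cast)
      have ha : p.coeff 0 = 0 := hC _ (hpC ▸ hp)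
      rw [hpC, ha, C_0]
  refine key (p.totalDegree + 1) p hp fun m hm => ?_
  by_contra hne
  have := le_totalDegree (mem_support_iff.2 hne)
  exact absurd (hm.trans this) (by omega)

variable {S : Type*} (L : Type*) [CommRing S] [Field L] [Algebra S L]

/-- The `S`-submodule of `L` spanned by the inverses of the powers of the members of `U`. -/
def invPowSpan (U : Set S) : Submodule S L :=
  Submodule.span S {y | ∃ u ∈ U, ∃ t : ℕ, y = (algebraMap S L u)⁻¹ ^ t}

variable {L}

theorem mem_invPowSpan_of_pow_mul {U : Set S} {u : S} (hu : u ∈ U) (hu0 : algebraMap S L u ≠ 0)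
    {t : ℕ} {y : L} {s : S} (h : algebraMap S L u ^ t * y = algebraMap S L s) :
    y ∈ invPowSpan L U := by
  have : y = s • (algebraMap S L u)⁻¹ ^ t := by
    rw [Algebra.smul_def, ← h, mul_right_comm, ← mul_pow, mul_inv_cancel₀ hu0, one_pow, one_mul]
  rw [this]
  exact Submodule.smul_mem _ _ (Submodule.subset_span ⟨u, hu, t, rfl⟩)

theorem exists_pow_mul_of_mem_invPowSpan_singleton {u : S} (hu0 : algebraMap S L u ≠ 0) {y : L}
    (h : y ∈ invPowSpan L {u}) : ∃ (t : ℕ) (s : S), algebraMap S L u ^ t * y = algebraMap S L s := by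
  induction h using Submodule.span_induction with
  | mem x hx =>
    obtain ⟨_, rfl, t, rfl⟩ := hx
    exact ⟨t, 1, by rw [← mul_pow, mul_inv_cancel₀ hu0, one_pow, map_one]⟩
  | zero => exact ⟨0, 0, by simp⟩
  | add x y _ _ hx hy =>
    obtain ⟨t, s, h⟩ := hx
    obtain ⟨t', s', h'⟩ := hy
    refine ⟨t + t', u ^ t' * s + u ^ t * s', ?_⟩
    rw [map_add, map_mul, map_mul, ← h, ← h', map_pow, map_pow]
    ring
  | smul a x _ hx =>
    obtain ⟨t, s, h⟩ := hx
    exact ⟨t, a * s, by rw [map_mul, ← h, Algebra.smul_def]; ring⟩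

theorem Derivation.apply_mem_invPowSpan {K : Type*} [CommRing K] [Algebra K L] {U : Set S}
    (D : Derivation K L L) (hD : ∀ s : S, ∃ s' : S, D (algebraMap S L s) = algebraMap S L s') {y : L}
    (hy : y ∈ invPowSpan L U) : D y ∈ invPowSpan L U := by
  induction hy using Submodule.span_induction with
  | mem x hx =>
    obtain ⟨u, hu, t, rfl⟩ := hx
    obtain ⟨s', hs'⟩ := hD u
    rw [Derivation.leibniz_pow, Derivation.leibniz_inv, hs']
    cases t with
    | zero => simp
    | succ t =>
      have : (t + 1) • (algebraMap S L u)⁻¹ ^ (t + 1 - 1) •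
          -(algebraMap S L u)⁻¹ ^ 2 • algebraMap S L s' =
          (-((t + 1 : ℕ) : S) * s') • (algebraMap S L u)⁻¹ ^ (t + 2) := by
        rw [nsmul_eq_mul]
        simp only [Algebra.smul_def, map_mul, map_neg, _root_.map_natCast, Algebra.algebraMap_self,
          RingHom.id_apply, Nat.add_sub_cancel]
        ring
      rw [this]
      exact Submodule.smul_mem _ _ (Submodule.subset_span ⟨u, hu, _, rfl⟩)
  | zero => simp
  | add x y _ _ hx hy => rw [map_add]; exact add_mem hx hy
  | smul a x hx hDx =>
    obtain ⟨s', hs'⟩ := hD a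
    rw [Algebra.smul_def, Derivation.leibniz, hs', smul_eq_mul, smul_eq_mul, mul_comm x,
      ← Algebra.smul_def, ← Algebra.smul_def]
    exact add_mem (Submodule.smul_mem _ _ hDx) (Submodule.smul_mem _ _ hx)

section CechQuotient

variable {S ι : Type} [CommRing S] [Fintype ι] [DecidableEq ι]

/-- The sum of the localizations of `S` at the products of all but one of the `g i`, inside `L`. -/
def cechBoundary (L : Type*) [Field L] [Algebra S L] (g : ι → S) : Submodule S L :=
  invPowSpan L (Set.range fun i => ∏ j ∈ univ.erase i, g j)

/-- The localization of `S` at the product of the `g i`, inside `L`. -/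
def cechCochain (L : Type*) [Field L] [Algebra S L] (g : ι → S) : Submodule S L :=
  invPowSpan L {∏ i, g i}

/-- The cokernel of the last map in the Čech complex of the `g i`. -/
abbrev CechQuotient (L : Type*) [Field L] [Algebra S L] (g : ι → S) : Type _ :=
  cechCochain L g ⧸ (cechBoundary L g).comap (cechCochain L g).subtype

variable {L : Type} [Field L] [Algebra S L] {g : ι → S}

omit [DecidableEq ι] in
theorem prod_toList_map (g : ι → S) : (univ.toList.map g).prod = ∏ i, g i := by
  simp

omit [CommRing S] [DecidableEq ι] in
theorem mem_toList_map {g : ι → S} {a : S} : a ∈ univ.toList.map g ↔ ∃ i, g i = a := by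
  simp

omit [Fintype ι] [DecidableEq ι] in
theorem algebraMap_prod_ne_zero (hg : ∀ i, algebraMap S L (g i) ≠ 0) (A : Finset ι) :
    algebraMap S L (∏ i ∈ A, g i) ≠ 0 := by
  rw [map_prod]
  exact prod_ne_zero_iff.2 fun i _ => hg i

theorem mem_cechBoundary_iff (hg : ∀ i, algebraMap S L (g i) ≠ 0) {y : L} :
    y ∈ cechBoundary L g ↔ ∃ (t : ℕ), ∃ p ∈ powIdeal (univ.toList.map g) t,
      algebraMap S L (∏ i, g i) ^ t * y = algebraMap S L p := by
  have hG := algebraMap_prod_ne_zero hg univ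
  have hmul : ∀ i, algebraMap S L (∏ i, g i) =
      algebraMap S L (g i) * algebraMap S L (∏ j ∈ univ.erase i, g j) := fun i => by
    rw [← map_mul, mul_prod_erase _ _ (mem_univ i)]
  constructor
  · intro hy
    induction hy using Submodule.span_induction with
    | mem x hx =>
      obtain ⟨_, ⟨i, rfl⟩, t, rfl⟩ := hx
      refine ⟨t, g i ^ t, Ideal.subset_span ⟨g i, mem_toList_map.2 ⟨i, rfl⟩, rfl⟩, ?_⟩
      rw [hmul i, mul_pow, mul_assoc, ← mul_pow (algebraMap S L (∏ j ∈ univ.erase i, g j)),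
        mul_inv_cancel₀ (algebraMap_prod_ne_zero hg _), one_pow, mul_one, map_pow]
    | zero => exact ⟨0, 0, zero_mem _, by simp⟩
    | add x y _ _ hx hy =>
      obtain ⟨t, p, hp, h⟩ := hx
      obtain ⟨t', p', hp', h'⟩ := hy
      have h1 := prod_pow_mul_mem_powIdeal _ t t' hp
      have h2 := prod_pow_mul_mem_powIdeal _ t' t hp'
      rw [add_comm t'] at h2
      rw [prod_toList_map] at h1 h2
      refine ⟨t + t', _, add_mem h1 h2, ?_⟩
      rw [map_add, map_mul, map_mul, ← h, ← h', map_pow, map_pow]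
      ring
    | smul a x _ hx =>
      obtain ⟨t, p, hp, h⟩ := hx
      exact ⟨t, a * p, Ideal.mul_mem_left _ _ hp, by rw [map_mul, ← h, Algebra.smul_def]; ring⟩
  · rintro ⟨t, p, hp, h⟩
    have hy : y = p • (algebraMap S L (∏ i, g i))⁻¹ ^ t := by
      rw [Algebra.smul_def, ← h, mul_right_comm, ← mul_pow, mul_inv_cancel₀ hG, one_pow, one_mul]
    rw [hy]
    clear h hy
    induction hp using Submodule.span_induction with
    | mem x hx =>
      obtain ⟨_, ha, rfl⟩ := hx
      obtain ⟨i, rfl⟩ := mem_toList_map.1 ha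
      refine mem_invPowSpan_of_pow_mul (t := t) (s := 1) (Set.mem_range_self i) (algebraMap_prod_ne_zero hg _) ?_
      simp only [Algebra.smul_def, map_pow, hmul i]
      rw [mul_inv, mul_pow, ← mul_assoc, ← mul_assoc, ← mul_pow, ← mul_pow, ← mul_pow, map_one]
      have := hg i
      have := algebraMap_prod_ne_zero hg (univ.erase i)
      field_simp
      simp
    | zero => simp
    | add x y _ _ hx hy => rw [add_smul]; exact add_mem hx hy
    | smul a x _ hx => rw [smul_eq_mul, mul_smul]; exact Submodule.smul_mem _ _ hx

theorem nonempty_localCohomology_equiv_cechQuotient [IsNoetherianRing S] [FaithfulSMul S L]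
    [Nonempty ι] (hg : ∀ i, algebraMap S L (g i) ≠ 0) {d : ℕ} (hd : Fintype.card ι = d)
    {I : Ideal S} (hI : I = Ideal.span (Set.range g)) :
    Nonempty ((localCohomology I d).obj (ModuleCat.of S S) ≃ₗ[S] CechQuotient L g) := by
  have hG := algebraMap_prod_ne_zero hg univ
  have hinj : Function.Injective (algebraMap S L) := FaithfulSMul.algebraMap_injective S L
  let φ : ℕ → S →ₗ[S] CechQuotient L g := fun t =>
    Submodule.mkQ _ ∘ₗ (LinearMap.toSpanSingleton S L
      ((algebraMap S L (∏ i, g i))⁻¹ ^ t)).codRestrict (cechCochain L g) fun p =>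
        Submodule.smul_mem _ _ (Submodule.subset_span ⟨_, rfl, t, rfl⟩)
  have hφ : ∀ t p (y : L) (hy : y ∈ cechCochain L g),
      algebraMap S L (∏ i, g i) ^ t * y = algebraMap S L p →
      φ t p = Submodule.Quotient.mk ⟨y, hy⟩ := by
    intro t p y hy h
    refine congrArg Submodule.Quotient.mk (Subtype.ext ?_)
    change p • (algebraMap S L (∏ i, g i))⁻¹ ^ t = y
    rw [Algebra.smul_def, ← h, mul_right_comm, ← mul_pow, mul_inv_cancel₀ hG, one_pow, one_mul]
  have hmem : ∀ t p, (algebraMap S L (∏ i, g i))⁻¹ ^ t * algebraMap S L p ∈ cechCochain L g :=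
    fun t p => mem_invPowSpan_of_pow_mul (t := t) (s := p) (Set.mem_singleton _) hG (by
      rw [← mul_assoc, ← mul_pow, mul_inv_cancel₀ hG, one_pow, one_mul])
  have hφ' : ∀ t p, φ t p = Submodule.Quotient.mk ⟨_, hmem t p⟩ := fun t p =>
    hφ t p _ _ (by rw [← mul_assoc, ← mul_pow, mul_inv_cancel₀ hG, one_pow, one_mul])
  have h : IsTopCech (univ.toList.map g) φ := by
    refine ⟨fun t p => ?_, fun w => ?_, fun t p => ?_⟩
    · rw [hφ' t p]
      refine hφ _ _ _ _ ?_
      rw [prod_toList_map, pow_succ', map_mul, mul_assoc]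
      congr 1
      rw [← mul_assoc, ← mul_pow, mul_inv_cancel₀ hG, one_pow, one_mul]
    · obtain ⟨⟨y, hy⟩, rfl⟩ := Submodule.Quotient.mk_surjective _ w
      obtain ⟨t, s, h⟩ := exists_pow_mul_of_mem_invPowSpan_singleton hG hy
      exact ⟨t, s, hφ _ _ _ _ h⟩
    · rw [hφ', Submodule.Quotient.mk_eq_zero, Submodule.mem_comap, Submodule.subtype_apply,
        mem_cechBoundary_iff hg, prod_toList_map]
      constructor
      · rintro ⟨r, s, hs, h⟩
        refine ⟨r, ?_⟩
        have h1 : (∏ i, g i) ^ r * p = (∏ i, g i) ^ t * s := by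
          apply hinj
          rw [map_mul, map_mul, ← h, map_pow, map_pow]
          simp only [inv_pow]
          field_simp
        rw [h1, add_comm, ← prod_toList_map]
        exact prod_pow_mul_mem_powIdeal _ _ _ hs
      · rintro ⟨r, hr⟩
        refine ⟨t + r, _, hr, ?_⟩
        rw [map_mul, map_pow, pow_add]
        simp only [inv_pow]
        field_simp
  have hne : univ.toList.map g ≠ [] := by simpa using univ_nonempty.ne_empty
  have hl : (univ.toList.map g).length = d := by simpa using hd
  have hspan : Ideal.span {a | a ∈ univ.toList.map g} = I := by
    rw [hI]
    congr 1
    ext a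
    simp
  rw [← hl, ← hspan]
  exact h.localCohomology_equiv hne

end CechQuotient

section ConstantCoeffAction

variable {K σ L : Type*} [Field K] [Field L] [Algebra (MvPolynomial σ K) L] [Algebra K L]
  [IsScalarTower K (MvPolynomial σ K) L]

/-- `D` extends the partial derivatives to `L`, and `Φ` is the corresponding action of polynomials
as constant coefficient differential operators. -/
structure IsConstantCoeffAction (D : σ → Derivation K L L)
    (Φ : MvPolynomial σ K →ₐ[K] Module.End K L) : Prop where
  apply_algebraMap : ∀ v p, D v (algebraMap (MvPolynomial σ K) L p) = algebraMap _ L (pderiv v p)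
  apply_X : ∀ v y, Φ (X v) y = D v y

namespace IsConstantCoeffAction

variable {D : σ → Derivation K L L} {Φ : MvPolynomial σ K →ₐ[K] Module.End K L}

omit [Algebra (MvPolynomial σ K) L] [IsScalarTower K (MvPolynomial σ K) L] in
theorem apply_C (a : K) (y : L) : Φ (C a) y = a • y := by
  have : C a = algebraMap K (MvPolynomial σ K) a := rfl
  rw [this, AlgHom.commutes]
  rfl

variable (hΦ : IsConstantCoeffAction D Φ)
include hΦ

theorem apply_mem_invPowSpan {U : Set (MvPolynomial σ K)} (p : MvPolynomial σ K) {y : L}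
    (hy : y ∈ invPowSpan L U) : Φ p y ∈ invPowSpan L U := by
  induction p using MvPolynomial.induction_on generalizing y with
  | C a =>
    rw [apply_C, ← algebraMap_smul (MvPolynomial σ K)]
    exact Submodule.smul_mem _ _ hy
  | add p q hp hq => rw [map_add]; exact add_mem (hp hy) (hq hy)
  | mul_X p v hp =>
    rw [map_mul, Module.End.mul_apply, hΦ.apply_X]
    exact hp ((D v).apply_mem_invPowSpan (fun s => ⟨_, hΦ.apply_algebraMap v s⟩) hy)

theorem apply_X_smul (p : MvPolynomial σ K) (v : σ) (y : L) :
    Φ p ((X v : MvPolynomial σ K) • y) = (X v : MvPolynomial σ K) • Φ p y + Φ (pderiv v p) y := by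
  classical
  induction p using MvPolynomial.induction_on generalizing y with
  | C a => rw [apply_C, apply_C, pderiv_C, map_zero, LinearMap.zero_apply, add_zero, smul_comm]
  | add p q hp hq =>
    simp only [map_add, LinearMap.add_apply, hp, hq, smul_add]
    abel
  | mul_X p w hp =>
    have h1 : D w ((X v : MvPolynomial σ K) • y) =
        (X v : MvPolynomial σ K) • D w y + (Pi.single v 1 : σ → K) w • y := by
      rw [Algebra.smul_def, Derivation.leibniz, hΦ.apply_algebraMap, pderiv_X, smul_eq_mul, smul_eq_mul,
        Algebra.smul_def]
      by_cases h : w = v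
      · subst h; simp
      · simp [h, Ne.symm h]
    have h2 : pderiv v (p * X w) = pderiv v p * X w + C ((Pi.single v 1 : σ → K) w) * p := by
      rw [pderiv_mul, pderiv_X, mul_comm p]
      by_cases h : w = v
      · subst h; simp
      · simp [h]
    rw [map_mul, Module.End.mul_apply, hΦ.apply_X, h1, map_add, hp, map_smul, h2, map_add, map_mul,
      map_mul, LinearMap.add_apply, Module.End.mul_apply, Module.End.mul_apply,
      Module.End.mul_apply, apply_C, hΦ.apply_X]
    abel

end IsConstantCoeffAction

end ConstantCoeffAction

section LaurentMonomials

variable {K σ ι L : Type} [Field K] [Field L] [Algebra (MvPolynomial σ K) L] [Algebra K L]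
  [Fintype ι] [DecidableEq ι]

/-- The Laurent monomial with exponents `s` in the `g j`. -/
noncomputable def zpowMonomial (L : Type*) [Field L] [Algebra (MvPolynomial σ K) L] (g : ι → MvPolynomial σ K)
    (s : ι → ℤ) : L :=
  ∏ j, algebraMap (MvPolynomial σ K) L (g j) ^ s j

/-- A family of polynomials whose members act as constant coefficient differential operators on
Laurent monomials in the family by lowering exponents, as in Cayley's identity. -/
structure IsCayleySystem (Φ : MvPolynomial σ K →ₐ[K] Module.End K L) (g : ι → MvPolynomial σ K) :
    Prop where
  ne_zero : ∀ i, algebraMap (MvPolynomial σ K) L (g i) ≠ 0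
  X_smul_mem : ∀ v, (X v : MvPolynomial σ K) • zpowMonomial L g (-1) ∈ cechBoundary L g
  apply_monomial : ∀ i s, (∀ j, s j < 0) ∨ (∀ j, 0 ≤ s j) →
    ∃ c : K, Φ (g i) (zpowMonomial L g s) = c • zpowMonomial L g (s - Pi.single i 1) ∧
      (c = 0 ↔ s i = 0)

omit [Algebra K L] [DecidableEq ι] in
theorem zpowMonomial_const {g : ι → MvPolynomial σ K} (t : ℤ) :
    zpowMonomial L g (fun _ => t) = algebraMap _ L (∏ i, g i) ^ t := by
  rw [zpowMonomial, prod_zpow, map_prod]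

namespace IsCayleySystem

variable {D : σ → Derivation K L L} {Φ : MvPolynomial σ K →ₐ[K] Module.End K L}
  {g : ι → MvPolynomial σ K} (hg : IsCayleySystem Φ g)
include hg

theorem apply_prod (μ : Multiset ι) (s : ι → ℤ)
    (hs : (∀ j, s j < 0) ∨ ∀ j, (μ.count j : ℤ) ≤ s j) :
    ∃ c : K, c ≠ 0 ∧ Φ (μ.map g).prod (zpowMonomial L g s) =
      c • zpowMonomial L g (fun j => s j - μ.count j) := by
  induction μ using Multiset.induction_on with
  | empty => exact ⟨1, one_ne_zero, by simp⟩
  | cons i μ ih =>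
    have hle : ∀ j, (μ.count j : ℤ) ≤ ((i ::ₘ μ).count j : ℤ) := fun j => by
      exact_mod_cast Multiset.count_le_count_cons j i μ
    obtain ⟨c, hc, h⟩ := ih (hs.imp id fun h j => (hle j).trans (h j))
    obtain ⟨c', h', hc'⟩ := hg.apply_monomial i (fun j => s j - μ.count j)
      (hs.imp (fun h j => by have := h j; omega) fun h j => by have := h j; have := hle j; omega)
    refine ⟨c * c', mul_ne_zero hc (hc'.not.2 ?_), ?_⟩
    · rcases hs with hs | hs
      · have := hs i; omega
      · have := hs i
        rw [Multiset.count_cons_self] at this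
        push_cast at this
        omega
    · rw [Multiset.map_cons, Multiset.prod_cons, map_mul, Module.End.mul_apply, h, map_smul, h',
        smul_smul]
      congr 2
      funext j
      rw [Multiset.count_cons, Pi.sub_apply, Pi.single_apply]
      split_ifs <;> push_cast <;> ring

theorem apply_prod_pow (t : ℕ) (s : ℤ) (hs : s < 0 ∨ t ≤ s) :
    ∃ c : K, c ≠ 0 ∧ Φ ((∏ i, g i) ^ t) (algebraMap _ L (∏ i, g i) ^ s) =
      c • algebraMap _ L (∏ i, g i) ^ (s - t) := by
  have h := hg.apply_prod (t • univ.val) (fun _ => s) (by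
    simpa [Multiset.count_nsmul, Multiset.count_univ] using hs.imp (fun h _ => h) fun h _ => h)
  simpa [Multiset.map_nsmul, Multiset.prod_nsmul, zpowMonomial_const] using h

theorem apply_pow_eq_zero (i : ι) (t : ℕ) :
    Φ (g i ^ (t + 1)) (algebraMap _ L (∏ i, g i) ^ (t : ℤ)) = 0 := by
  obtain ⟨c, -, h⟩ := hg.apply_prod (Multiset.replicate t i) (fun _ => t) (Or.inr fun j => by
    rw [Multiset.count_replicate]; split_ifs <;> simp)
  rw [Multiset.map_replicate, Multiset.prod_replicate, zpowMonomial_const] at h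
  obtain ⟨c', h', hc'⟩ := hg.apply_monomial i
    (fun j => t - (Multiset.replicate t i).count j) (Or.inr fun j => by
      rw [Multiset.count_replicate]; split_ifs <;> simp)
  rw [pow_succ', map_mul, Module.End.mul_apply, h, map_smul, h', hc'.2 (by simp), zero_smul, smul_zero]

theorem inv_notMem [FaithfulSMul (MvPolynomial σ K) L] :
    (algebraMap _ L (∏ i, g i))⁻¹ ∉ cechBoundary L g := by
  rw [mem_cechBoundary_iff hg.ne_zero]
  rintro ⟨t, p, hp, h⟩
  have hG := algebraMap_prod_ne_zero hg.ne_zero univ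
  have hp' := prod_pow_mul_mem_powIdeal _ t 1 hp
  have h1 : (∏ i, g i) ^ 1 * p = (∏ i, g i) ^ t := by
    apply FaithfulSMul.algebraMap_injective (MvPolynomial σ K) L
    rw [map_mul, ← h, map_pow, map_pow, pow_one, mul_left_comm, mul_inv_cancel₀ hG, mul_one]
  rw [prod_toList_map, h1] at hp'
  obtain ⟨c, hc, h2⟩ := hg.apply_prod_pow t t (Or.inr le_rfl)
  rw [sub_self, zpow_zero] at h2
  have h3 : ∀ q ∈ powIdeal (univ.toList.map g) (t + 1),
      Φ q (algebraMap _ L (∏ i, g i) ^ (t : ℤ)) = 0 := fun q hq => by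
    induction hq using Submodule.span_induction with
    | mem x hx =>
      obtain ⟨_, ha, rfl⟩ := hx
      obtain ⟨i, rfl⟩ := mem_toList_map.1 ha
      exact hg.apply_pow_eq_zero i t
    | zero => simp
    | add x y _ _ hx hy => rw [map_add, LinearMap.add_apply, hx, hy, add_zero]
    | smul a x _ hx => rw [smul_eq_mul, map_mul, Module.End.mul_apply, hx, map_zero]
  rw [h3 _ hp', eq_comm, smul_eq_zero] at h2
  exact h2.elim hc one_ne_zero

variable [IsScalarTower K (MvPolynomial σ K) L] (hΦ : IsConstantCoeffAction D Φ)
include hΦ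

theorem apply_pderiv_add_mem (p : MvPolynomial σ K) (v : σ) :
    (X v : MvPolynomial σ K) • Φ p (algebraMap _ L (∏ i, g i))⁻¹ +
      Φ (pderiv v p) (algebraMap _ L (∏ i, g i))⁻¹ ∈ cechBoundary L g := by
  rw [← hΦ.apply_X_smul]
  refine hΦ.apply_mem_invPowSpan p ?_
  rw [← zpow_neg_one, ← zpowMonomial_const]
  exact hg.X_smul_mem v

theorem eq_zero_of_apply_mem [CharZero K] [FaithfulSMul (MvPolynomial σ K) L]
    {p : MvPolynomial σ K} (hp : Φ p (algebraMap _ L (∏ i, g i))⁻¹ ∈ cechBoundary L g) : p = 0 := by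
  refine eq_zero_of_pderiv_closed
    (N := fun p => Φ p (algebraMap _ L (∏ i, g i))⁻¹ ∈ cechBoundary L g) (fun p v hp => ?_)
    (fun a ha => ?_) hp
  · exact ((cechBoundary L g).add_mem_iff_right ((cechBoundary L g).smul_mem _ hp)).1
      (hg.apply_pderiv_add_mem hΦ p v)
  · by_contra h
    refine hg.inv_notMem ?_
    have := (cechBoundary L g).smul_mem (C a⁻¹) ha
    rwa [IsConstantCoeffAction.apply_C, ← algebraMap_smul (MvPolynomial σ K) a, ← mul_smul, algebraMap_eq, ← C_mul,
      inv_mul_cancel₀ h, C_1, one_smul] at this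

theorem exists_sub_apply_mem [Nonempty ι] {y : L} (hy : y ∈ cechCochain L g) :
    ∃ p, y - Φ p (algebraMap _ L (∏ i, g i))⁻¹ ∈ cechBoundary L g := by
  induction hy using Submodule.span_induction with
  | mem x hx =>
    obtain ⟨_, rfl, t, rfl⟩ := hx
    cases t with
    | zero =>
      refine ⟨0, ?_⟩
      rw [map_zero, LinearMap.zero_apply, sub_zero]
      exact Submodule.subset_span ⟨_, Set.mem_range_self (Classical.arbitrary ι), 0, by simp⟩
    | succ t =>
      obtain ⟨c, hc, h⟩ := hg.apply_prod_pow t (-1) (Or.inl (by simp))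
      refine ⟨C c⁻¹ * (∏ i, g i) ^ t, ?_⟩
      rw [← zpow_neg_one (algebraMap _ L (∏ i, g i)), map_mul, Module.End.mul_apply, h, IsConstantCoeffAction.apply_C,
        smul_smul, inv_mul_cancel₀ hc, one_smul, ← zpow_natCast, ← zpow_mul]
      have : (-1 : ℤ) * ((t + 1 : ℕ) : ℤ) = -1 - t := by push_cast; ring
      rw [this, sub_self]
      exact zero_mem _
  | zero => exact ⟨0, by simp⟩
  | add x y _ _ hx hy =>
    obtain ⟨p, hp⟩ := hx
    obtain ⟨q, hq⟩ := hy
    refine ⟨p + q, ?_⟩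
    rw [map_add, LinearMap.add_apply, add_sub_add_comm]
    exact add_mem hp hq
  | smul a x _ hx =>
    obtain ⟨p, hp⟩ := hx
    induction a using MvPolynomial.induction_on generalizing x p with
    | C a =>
      refine ⟨C a * p, ?_⟩
      rw [map_mul, Module.End.mul_apply, IsConstantCoeffAction.apply_C, ← algebraMap_smul (MvPolynomial σ K) a,
        algebraMap_eq, ← smul_sub]
      exact Submodule.smul_mem _ _ hp
    | add a b ha hb =>
      obtain ⟨q, hq⟩ := ha x ‹_› p hp
      obtain ⟨r, hr⟩ := hb x ‹_› p hp
      refine ⟨q + r, ?_⟩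
      rw [map_add, LinearMap.add_apply, add_smul, add_sub_add_comm]
      exact add_mem hq hr
    | mul_X a v ha =>
      rw [mul_smul]
      refine ha _ (Submodule.smul_mem _ _ ‹_›) (-pderiv v p) ?_
      have := add_mem ((cechBoundary L g).smul_mem (X v) hp) (hg.apply_pderiv_add_mem hΦ p v)
      rwa [smul_sub, ← add_assoc, sub_add_cancel, ← sub_neg_eq_add, ← LinearMap.neg_apply, ← map_neg] at this

end IsCayleySystem

theorem IsCayleySystem.nonempty_cechQuotient_equiv [CharZero K] [IsScalarTower K (MvPolynomial σ K) L]
    [FaithfulSMul (MvPolynomial σ K) L] {ι' : Type} [Fintype ι'] [DecidableEq ι'] [Nonempty ι]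
    [Nonempty ι'] {D : σ → Derivation K L L} {Φ : MvPolynomial σ K →ₐ[K] Module.End K L}
    (hΦ : IsConstantCoeffAction D Φ) {g : ι → MvPolynomial σ K} (hg : IsCayleySystem Φ g)
    {h : ι' → MvPolynomial σ K} (hh : IsCayleySystem Φ h) :
    Nonempty (CechQuotient L g ≃ₗ[MvPolynomial σ K] CechQuotient L h) := by
  have mem_g : ∀ p, Φ p (algebraMap _ L (∏ i, g i))⁻¹ ∈ cechCochain L g := fun p =>
    hΦ.apply_mem_invPowSpan p (Submodule.subset_span ⟨_, rfl, 1, (pow_one _).symm⟩)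
  have mem_h : ∀ p, Φ p (algebraMap _ L (∏ i, h i))⁻¹ ∈ cechCochain L h := fun p =>
    hΦ.apply_mem_invPowSpan p (Submodule.subset_span ⟨_, rfl, 1, (pow_one _).symm⟩)
  let A : MvPolynomial σ K → CechQuotient L g := fun p => Submodule.Quotient.mk ⟨_, mem_g p⟩
  let B : MvPolynomial σ K → CechQuotient L h := fun p => Submodule.Quotient.mk ⟨_, mem_h p⟩
  have A0 : ∀ p, A p = 0 ↔ p = 0 := fun p => by
    refine ((Submodule.Quotient.mk_eq_zero _).trans Submodule.mem_comap).trans ⟨fun H => ?_, ?_⟩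
    · exact hg.eq_zero_of_apply_mem hΦ H
    · rintro rfl; simp
  have B0 : ∀ p, B p = 0 ↔ p = 0 := fun p => by
    refine ((Submodule.Quotient.mk_eq_zero _).trans Submodule.mem_comap).trans ⟨fun H => ?_, ?_⟩
    · exact hh.eq_zero_of_apply_mem hΦ H
    · rintro rfl; simp
  have Aadd : ∀ p q, A (p + q) = A p + A q := fun p q => by
    rw [← Submodule.Quotient.mk_add]
    exact congrArg _ (Subtype.ext (by simp))
  have Badd : ∀ p q, B (p + q) = B p + B q := fun p q => by
    rw [← Submodule.Quotient.mk_add]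
    exact congrArg _ (Subtype.ext (by simp))
  have AC : ∀ a p, A (C a * p) = (C a : MvPolynomial σ K) • A p := fun a p => by
    rw [← Submodule.Quotient.mk_smul]
    refine congrArg _ (Subtype.ext ?_)
    change Φ _ _ = (C a : MvPolynomial σ K) • Φ _ _
    rw [map_mul, Module.End.mul_apply, IsConstantCoeffAction.apply_C, ← algebraMap_eq,
      algebraMap_smul]
  have BC : ∀ a p, B (C a * p) = (C a : MvPolynomial σ K) • B p := fun a p => by
    rw [← Submodule.Quotient.mk_smul]
    refine congrArg _ (Subtype.ext ?_)
    change Φ _ _ = (C a : MvPolynomial σ K) • Φ _ _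
    rw [map_mul, Module.End.mul_apply, IsConstantCoeffAction.apply_C, ← algebraMap_eq,
      algebraMap_smul]
  have AX : ∀ v p, A (-pderiv v p) = (X v : MvPolynomial σ K) • A p := fun v p => by
    rw [← Submodule.Quotient.mk_smul, eq_comm]
    refine (Submodule.Quotient.eq _).2 (Submodule.mem_comap.2 ?_)
    change (X v : MvPolynomial σ K) • Φ _ _ - Φ _ _ ∈ _
    rw [map_neg, LinearMap.neg_apply, sub_neg_eq_add]
    exact hg.apply_pderiv_add_mem hΦ p v
  have BX : ∀ v p, B (-pderiv v p) = (X v : MvPolynomial σ K) • B p := fun v p => by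
    rw [← Submodule.Quotient.mk_smul, eq_comm]
    refine (Submodule.Quotient.eq _).2 (Submodule.mem_comap.2 ?_)
    change (X v : MvPolynomial σ K) • Φ _ _ - Φ _ _ ∈ _
    rw [map_neg, LinearMap.neg_apply, sub_neg_eq_add]
    exact hh.apply_pderiv_add_mem hΦ p v
  have ABsmul : ∀ a p, ∃ q, A q = a • A p ∧ B q = a • B p := fun a => by
    induction a using MvPolynomial.induction_on with
    | C a => exact fun p => ⟨_, AC a p, BC a p⟩
    | add a b ha hb =>
      intro p
      obtain ⟨q, hq⟩ := ha p
      obtain ⟨r, hr⟩ := hb p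
      exact ⟨q + r, by rw [Aadd, hq.1, hr.1, add_smul], by rw [Badd, hq.2, hr.2, add_smul]⟩
    | mul_X a v ha =>
      intro p
      obtain ⟨q, hq⟩ := ha (-pderiv v p)
      exact ⟨q, by rw [hq.1, AX, mul_smul], by rw [hq.2, BX, mul_smul]⟩
  refine LinearEquiv.nonempty_of_relation (S := MvPolynomial σ K)
    { carrier := Set.range fun p => (A p, B p)
      add_mem' := ?_
      zero_mem' := ⟨0, Prod.ext ((A0 0).2 rfl) ((B0 0).2 rfl)⟩
      smul_mem' := ?_ } ?_ ?_ ?_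
  · rintro _ _ ⟨p, rfl⟩ ⟨q, rfl⟩
    exact ⟨p + q, Prod.ext (Aadd p q) (Badd p q)⟩
  · rintro a _ ⟨p, rfl⟩
    obtain ⟨q, hq⟩ := ABsmul a p
    exact ⟨q, Prod.ext hq.1 hq.2⟩
  · intro a
    obtain ⟨⟨y, hy⟩, rfl⟩ := Submodule.Quotient.mk_surjective _ a
    obtain ⟨p, hp⟩ := hg.exists_sub_apply_mem hΦ hy
    exact ⟨B p, p, Prod.ext ((Submodule.Quotient.eq _).2 (Submodule.mem_comap.2 hp)).symm rfl⟩
  · intro b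
    obtain ⟨⟨y, hy⟩, rfl⟩ := Submodule.Quotient.mk_surjective _ b
    obtain ⟨p, hp⟩ := hh.exists_sub_apply_mem hΦ hy
    exact ⟨A p, p, Prod.ext rfl ((Submodule.Quotient.eq _).2 (Submodule.mem_comap.2 hp)).symm⟩
  · rintro a b ⟨p, hp⟩
    obtain ⟨rfl, rfl⟩ := Prod.ext_iff.1 hp
    exact (A0 p).trans (B0 p).symm

end LaurentMonomials

section ConcreteSystems

theorem Derivation.apply_prod_zpow {K L ι : Type*} [Field K] [Field L] [Algebra K L]
    (D : Derivation K L L) (A : Finset ι) {a : ι → L} (ha : ∀ i, a i ≠ 0) (s : ι → ℤ) :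
    D (∏ i ∈ A, a i ^ s i) =
      (∑ i ∈ A, (s i : K) • (D (a i) * (a i)⁻¹)) * ∏ i ∈ A, a i ^ s i := by
  classical
  induction A using Finset.induction_on with
  | empty => simp
  | insert i A hi ih =>
    rw [prod_insert hi, sum_insert hi, Derivation.leibniz, ih, Derivation.leibniz_zpow,
      zpow_sub_one₀ (ha i)]
    simp only [smul_eq_mul, Int.cast_smul_eq_zsmul, zsmul_eq_mul]
    ring

variable {K σ ι L : Type} [Field K] [Field L] [Algebra (MvPolynomial σ K) L] [Algebra K L]
  [Fintype ι] [DecidableEq ι] {g : ι → MvPolynomial σ K}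

omit [Algebra K L] in
theorem zpowMonomial_sub_single (hg : ∀ i, algebraMap (MvPolynomial σ K) L (g i) ≠ 0) (s : ι → ℤ)
    (i : ι) : zpowMonomial L g (s - Pi.single i 1) =
      zpowMonomial L g s * (algebraMap (MvPolynomial σ K) L (g i))⁻¹ := by
  have : ∀ j, algebraMap (MvPolynomial σ K) L (g j) ^ (s - Pi.single i 1 : ι → ℤ) j =
      algebraMap (MvPolynomial σ K) L (g j) ^ s j *
        (if j = i then (algebraMap (MvPolynomial σ K) L (g i))⁻¹ else 1) := fun j => by
    by_cases h : j = i
    · subst h; simp [zpow_sub_one₀ (hg j)]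
    · simp [h]
  simp_rw [zpowMonomial, this, prod_mul_distrib]
  simp

omit [Algebra K L] [DecidableEq ι] in
theorem zpowMonomial_neg_one : zpowMonomial L g (-1) = (algebraMap _ L (∏ i, g i))⁻¹ := by
  rw [← zpow_neg_one, ← zpowMonomial_const]
  rfl

omit [Algebra K L] in
theorem smul_zpowMonomial_neg_one_mem (hg : ∀ i, algebraMap (MvPolynomial σ K) L (g i) ≠ 0) (i : ι) :
    g i • zpowMonomial L g (-1) ∈ cechBoundary L g := by
  refine mem_invPowSpan_of_pow_mul (t := 1) (s := 1) (Set.mem_range_self i) (algebraMap_prod_ne_zero hg _) ?_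
  rw [zpowMonomial_neg_one, pow_one, Algebra.smul_def, mul_left_comm, ← mul_assoc, ← map_mul,
    mul_prod_erase _ _ (mem_univ i), mul_inv_cancel₀ (algebraMap_prod_ne_zero hg _), map_one]

theorem isCayleySystem_X [CharZero K] [DecidableEq σ] [Fintype σ]
    [FaithfulSMul (MvPolynomial σ K) L] [IsScalarTower K (MvPolynomial σ K) L]
    {D : σ → Derivation K L L} {Φ : MvPolynomial σ K →ₐ[K] Module.End K L}
    (hΦ : IsConstantCoeffAction D Φ) : IsCayleySystem Φ (X : σ → MvPolynomial σ K) := by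
  have h0 : ∀ v, algebraMap (MvPolynomial σ K) L (X v) ≠ 0 := fun v =>
    (map_ne_zero_iff _ (FaithfulSMul.algebraMap_injective _ _)).2 (X_ne_zero v)
  refine ⟨h0, smul_zpowMonomial_neg_one_mem h0, fun v s _ => ⟨s v, ?_, Int.cast_eq_zero⟩⟩
  rw [hΦ.apply_X, zpowMonomial_sub_single h0, zpowMonomial,
    (D v).apply_prod_zpow univ h0, sum_eq_single v]
  · rw [hΦ.apply_algebraMap, pderiv_X_self, map_one, one_mul, smul_mul_assoc, mul_comm]
  · intro w _ hw
    rw [hΦ.apply_algebraMap, pderiv_X_of_ne hw, map_zero, zero_mul, smul_zero]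
  · simp

end ConcreteSystems

section GenericMatrix

variable {K L : Type} [Field K] [Field L] {p q : ℕ}

theorem MvPolynomial.det_ne_zero_of_apply_eq_X {σ κ : Type*} [Fintype κ] [DecidableEq κ]
    {f : κ × κ → σ} (hf : Function.Injective f) {A : Matrix κ κ (MvPolynomial σ K)}
    (hA : ∀ i j, A i j = X (f (i, j))) : A.det ≠ 0 := by
  have : A = (Matrix.mvPolynomialX κ κ K).map (rename f) := by
    ext1 i j
    rw [hA, Matrix.map_apply, Matrix.mvPolynomialX_apply, rename_X]
  rw [this, ← AlgHom.mapMatrix_apply, ← AlgHom.map_det]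
  exact (map_ne_zero_iff _ (rename_injective f hf)).2 (Matrix.det_mvPolynomialX_ne_zero κ K)

variable [Algebra (MvPolynomial (Fin (p + (q + 2)) × Fin (q + 1)) K) L] [Algebra K L]
  {M : Matrix (Fin (p + (q + 2))) (Fin (q + 1)) (MvPolynomial (Fin (p + (q + 2)) × Fin (q + 1)) K)}
  (hM : ∀ i j, M i j = X (i, j))
include hM

omit [Field L] [Algebra (MvPolynomial (Fin (p + (q + 2)) × Fin (q + 1)) K) L] [Algebra K L] in
theorem bottomSystem_ne_zero (i : (Fin p × Fin (q + 1)) ⊕ Fin (q + 2)) :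
    bottomSystem M i ≠ 0 := by
  cases i with
  | inl v => simp [bottomSystem, hM]
  | inr k =>
    refine mul_ne_zero (pow_ne_zero _ (neg_ne_zero.2 one_ne_zero)) ?_
    refine det_ne_zero_of_apply_eq_X (f := fun v => (bottomRows p k v.1, v.2)) (fun v w h => ?_)
      fun i j => hM _ _
    rw [Prod.mk.injEq] at h
    exact Prod.ext ((strictMono_bottomRows k).injective h.1) h.2

omit hM in
theorem sum_mul_bottomSystem {R : Type} [CommRing R] (M : Matrix (Fin (p + (q + 2))) (Fin (q + 1)) R)
    (l : Fin (q + 1)) : ∑ k, M (Fin.natAdd p k) l * bottomSystem M (Sum.inr k) = 0 := by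
  have : (Matrix.of fun k => (Fin.cons (M (Fin.natAdd p k) l) fun j => M (Fin.natAdd p k) j :
      Fin (q + 2) → R)).det = 0 :=
    Matrix.det_zero_of_column_eq (Fin.succ_ne_zero l).symm fun k => rfl
  rw [Matrix.det_succ_column_zero] at this
  rw [← this]
  refine sum_congr rfl fun k _ => ?_
  change _ = (-1) ^ (k : ℕ) * M (Fin.natAdd p k) l * (M.submatrix (bottomRows p k) id).det
  change _ * ((-1) ^ (k : ℕ) * _) = _
  ring

variable [FaithfulSMul (MvPolynomial (Fin (p + (q + 2)) × Fin (q + 1)) K) L]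

omit [Algebra K L] in
theorem X_smul_zpowMonomial_bottomSystem_mem (v : Fin (p + (q + 2)) × Fin (q + 1)) :
    (X v : MvPolynomial (Fin (p + (q + 2)) × Fin (q + 1)) K) •
      zpowMonomial L (bottomSystem M) (-1) ∈ cechBoundary L (bottomSystem M) := by
  have h0 : ∀ i, algebraMap _ L (bottomSystem M i) ≠ 0 := fun i =>
    (map_ne_zero_iff _ (FaithfulSMul.algebraMap_injective _ _)).2 (bottomSystem_ne_zero hM i)
  obtain ⟨i, l⟩ := v
  induction i using Fin.addCases with
  | left i =>
    have := smul_zpowMonomial_neg_one_mem h0 (Sum.inl (i, l))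
    rwa [show bottomSystem M (Sum.inl (i, l)) = X (Fin.castAdd _ i, l) from hM _ _] at this
  | right k =>
    set g := bottomSystem M with hg
    have h1 : (X (Fin.natAdd p k, l) : MvPolynomial (Fin (p + (q + 2)) × Fin (q + 1)) K) •
        zpowMonomial L g (-1) = -∑ k' ∈ univ.erase k, M (Fin.natAdd p k') l •
          (g (Sum.inr k') • zpowMonomial L g (-1)) * (algebraMap _ L (g (Sum.inr k)))⁻¹ := by
      have h2 := sum_mul_bottomSystem M l
      rw [← add_sum_erase _ _ (mem_univ k), hM, ← hg, add_eq_zero_iff_eq_neg] at h2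
      rw [← sum_mul]
      simp_rw [← mul_smul]
      rw [← sum_smul, ← neg_mul, ← neg_smul, ← h2, mul_smul, smul_mul_assoc,
        Algebra.smul_def (g _), mul_right_comm, mul_inv_cancel₀ (h0 _), one_mul]
    rw [h1]
    refine neg_mem (sum_mem fun k' hk' => ?_)
    rw [smul_mul_assoc]
    refine Submodule.smul_mem _ _ ?_
    refine mem_invPowSpan_of_pow_mul (t := 2)
      (s := ∏ j ∈ (univ.erase (Sum.inr k')).erase (Sum.inr k), g j) (Set.mem_range_self (Sum.inr k'))
      (algebraMap_prod_ne_zero h0 _) ?_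
    have hk : (Sum.inr k : (Fin p × Fin (q + 1)) ⊕ Fin (q + 2)) ∈ univ.erase (Sum.inr k') :=
      mem_erase.2 ⟨fun h => (mem_erase.1 hk').1 (Sum.inr_injective h).symm, mem_univ _⟩
    rw [zpowMonomial_neg_one, ← mul_prod_erase univ g (mem_univ (Sum.inr k')),
      ← mul_prod_erase _ g hk, Algebra.smul_def]
    have e1 := h0 (Sum.inr k)
    have e2 := h0 (Sum.inr k')
    have e3 := algebraMap_prod_ne_zero h0 ((univ.erase (Sum.inr k')).erase (Sum.inr k))
    simp only [map_mul]
    field_simp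

theorem isCayleySystem_bottomSystem [CharZero K]
    [IsScalarTower K (MvPolynomial (Fin (p + (q + 2)) × Fin (q + 1)) K) L]
    {D : Fin (p + (q + 2)) × Fin (q + 1) → Derivation K L L}
    {Φ : MvPolynomial (Fin (p + (q + 2)) × Fin (q + 1)) K →ₐ[K] Module.End K L}
    (hΦ : IsConstantCoeffAction D Φ) : IsCayleySystem Φ (bottomSystem M) := by
  set g := bottomSystem M with hg
  have h0 : ∀ i, algebraMap _ L (g i) ≠ 0 := fun i =>
    (map_ne_zero_iff _ (FaithfulSMul.algebraMap_injective _ _)).2 (bottomSystem_ne_zero hM i)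
  have hinl : ∀ v, g (Sum.inl v) = X (Fin.castAdd _ v.1, v.2) := fun v => hM _ _
  refine ⟨h0, X_smul_zpowMonomial_bottomSystem_mem hM, ?_⟩
  have hlog : ∀ v s, D v (zpowMonomial L g s) =
      (∑ i, (s i : K) • (D v (algebraMap _ L (g i)) * (algebraMap _ L (g i))⁻¹)) *
        zpowMonomial L g s := fun v s => (D v).apply_prod_zpow univ h0 s
  have hG : ∀ s a j, D (Fin.natAdd p a, j) (zpowMonomial L g s) =
      (∑ k, (s (Sum.inr k) : K) • (D (Fin.natAdd p a, j) (algebraMap _ L (g (Sum.inr k))) *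
        (algebraMap _ L (g (Sum.inr k)))⁻¹)) * zpowMonomial L g s := fun s a j => by
    rw [hlog, Fintype.sum_sum_type, sum_eq_zero, zero_add]
    intro v _
    rw [hinl, hΦ.apply_algebraMap, pderiv_X_of_ne, map_zero, zero_mul, smul_zero]
    intro h
    have := congrArg (fun w => (w.1 : ℕ)) h
    simp at this
    omega
  rintro (v | k) s hs
  · refine ⟨s (Sum.inl v), ?_, Int.cast_eq_zero⟩
    rw [hinl, hΦ.apply_X, zpowMonomial_sub_single h0, hlog, sum_eq_single (Sum.inl v)]
    · rw [hinl, hΦ.apply_algebraMap, pderiv_X_self, map_one, one_mul, smul_mul_assoc, mul_comm]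
    · rintro (w | k) _ hw
      · rw [hinl, hΦ.apply_algebraMap, pderiv_X_of_ne, map_zero, zero_mul, smul_zero]
        intro h
        rw [Prod.mk.injEq] at h
        exact hw (congrArg _ (Prod.ext (Fin.castAdd_injective _ _ h.1) h.2))
      · have : pderiv (Fin.castAdd (q + 2) v.1, v.2) (g (Sum.inr k)) = 0 := by
          have hdet : pderiv (Fin.castAdd (q + 2) v.1, v.2)
              (M.submatrix (bottomRows p k) id).det = 0 := by
            rw [Derivation.apply_det]
            refine sum_eq_zero fun i _ => Matrix.det_eq_zero_of_row_eq_zero i fun j => ?_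
            rw [Matrix.updateRow_self, Matrix.submatrix_apply, hM, pderiv_X_of_ne]
            intro h
            exact castAdd_notMem_range_bottomRows v.1 k ⟨i, congrArg Prod.fst h⟩
          change pderiv _ ((-1) ^ (k : ℕ) * _) = _
          rw [Derivation.leibniz, hdet, Derivation.leibniz_pow]
          simp
        rw [hΦ.apply_algebraMap, this, map_zero, zero_mul, smul_zero]
    · simp
  · let Y : Matrix (Fin (q + 2)) (Fin (q + 1)) (MvPolynomial (Fin (p + (q + 2)) × Fin (q + 1)) K) :=
      Matrix.of fun a j => X (Fin.natAdd p a, j)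
    have hY : ∀ k, g (Sum.inr k) = (-1) ^ (k : ℕ) * (Y.submatrix k.succAbove id).det := fun k => by
      have : M.submatrix (bottomRows p k) id = Y.submatrix k.succAbove id := by
        ext1 i j
        exact hM _ _
      rw [← this]
      rfl
    by_cases hσ : ∑ k, s (Sum.inr k) = 0
    · have hs0 : ∀ k, s (Sum.inr k) = 0 := by
        rcases hs with hs | hs
        · exact absurd hσ (sum_neg (fun k _ => hs (Sum.inr k)) univ_nonempty).ne
        · exact fun k => (sum_eq_zero_iff_of_nonneg fun k _ => hs (Sum.inr k)).1 hσ k (mem_univ k)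
      refine ⟨0, ?_, by simp [hs0]⟩
      have hD0 : ∀ a j, Φ (Y a j) (zpowMonomial L g s) = 0 := fun a j => by
        change Φ (X _) _ = 0
        rw [hΦ.apply_X, hG]
        simp [hs0]
      rw [zero_smul, hY, map_mul, Module.End.mul_apply, Matrix.det_succ_row_zero, map_sum,
        LinearMap.sum_apply, sum_eq_zero, map_zero]
      intro j _
      rw [mul_right_comm, map_mul, Module.End.mul_apply, Matrix.submatrix_apply, hD0, map_zero]
    · have hσK : ∑ k, (s (Sum.inr k) : K) ≠ 0 := by
        rw [← Int.cast_sum]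
        exact Int.cast_ne_zero.2 hσ
      have key := cayley_signed_minor Φ Y (fun a j => D (Fin.natAdd p a, j))
        (fun a j y => hΦ.apply_X _ y) (Y.map (algebraMap _ L)) (fun a j b l => ?_)
        (fun k => algebraMap _ L (g (Sum.inr k))) (fun k => ?_) (fun k => h0 _)
        (fun k => (s (Sum.inr k) : K)) hσK (zpowMonomial L g s) (hG s) k
      · rw [← hY, ← zpowMonomial_sub_single h0] at key
        refine ⟨_, key, ?_⟩
        rw [mul_eq_zero, mul_eq_zero, Int.cast_eq_zero, inv_eq_zero, or_iff_left hσK,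
          or_iff_left]
        refine prod_ne_zero_iff.2 ?_
        intro i hi
        rw [← Int.cast_sum, ← Int.cast_natCast, ← Int.cast_add, Int.cast_ne_zero]
        change ∑ k : Fin (q + 2), s (Sum.inr k) + (i : ℤ) ≠ 0
        rcases hs with hs | hs
        · have : ∑ k : Fin (q + 2), s (Sum.inr k) ≤ ∑ k : Fin (q + 2), (-1) :=
            sum_le_sum fun k _ => by have := hs (Sum.inr k); omega
          have hi' := mem_range.1 hi
          simp at this
          omega
        · have : 0 ≤ ∑ k : Fin (q + 2), s (Sum.inr k) := sum_nonneg fun k _ => hs (Sum.inr k)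
          omega
      · rw [Matrix.map_apply, hΦ.apply_algebraMap]
        change algebraMap _ L (pderiv _ (X _)) = _
        rw [pderiv_X, Pi.single_apply]
        simp only [Prod.mk.injEq, Fin.natAdd_inj]
        split_ifs with h1 h2 h2
        · exact map_one _
        · exact absurd ⟨h1.1.symm, h1.2.symm⟩ h2
        · exact absurd ⟨h2.1.symm, h2.2.symm⟩ h1
        · exact map_zero _
      · rw [hY, map_mul, map_pow, map_neg, map_one, RingHom.map_det]
        rfl

end GenericMatrix

end CayleySystem

open MvPolynomial

/-- The top nonvanishing local cohomology module `H^{n(m-n)+1}_I(S)` with support in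
the ideal `I` of maximal minors of the generic `m × n` matrix is isomorphic, as an
`S`-module, to `H^{mn}_𝔪(S)`, the local cohomology of `S` with support in the maximal
homogeneous ideal `𝔪` (the injective hull of the residue field). -/
theorem local_cohomology_maximal_minors_top
    (K : Type) [Field K] [CharZero K] (m n : ℕ) (hn : 1 ≤ n) (hmn : n < m)
    (X : Matrix (Fin m) (Fin n) (MvPolynomial (Fin m × Fin n) K))
    (hX : ∀ i j, X i j = MvPolynomial.X (i, j))
    (I : Ideal (MvPolynomial (Fin m × Fin n) K))
    (hI : I = Ideal.span {p | ∃ g : Fin n → Fin m, StrictMono g ∧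
      p = (X.submatrix g id).det})
    (𝔪 : Ideal (MvPolynomial (Fin m × Fin n) K))
    (h𝔪 : 𝔪 = Ideal.span (Set.range (MvPolynomial.X : Fin m × Fin n →
      MvPolynomial (Fin m × Fin n) K))) :
    Nonempty ((localCohomology I (n * (m - n) + 1)).obj
        (ModuleCat.of (MvPolynomial (Fin m × Fin n) K) (MvPolynomial (Fin m × Fin n) K)) ≅
      (localCohomology 𝔪 (m * n)).obj
        (ModuleCat.of (MvPolynomial (Fin m × Fin n) K) (MvPolynomial (Fin m × Fin n) K))) := by
  obtain ⟨q, rfl⟩ : ∃ q, n = q + 1 := ⟨n - 1, by omega⟩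
  obtain ⟨p, rfl⟩ : ∃ p, m = p + (q + 2) := ⟨m - (q + 2), by omega⟩
  have hd : (q + 1) * (p + (q + 2) - (q + 1)) + 1 = (q + 1) * p + q + 2 := by
    have : p + (q + 2) - (q + 1) = p + 1 := by omega
    rw [this]
    ring
  rw [hd]
  let S := MvPolynomial (Fin (p + (q + 2)) × Fin (q + 1)) K
  obtain ⟨D, Φ, h1, h2⟩ := exists_constantCoeff_action (K := K) (σ := Fin (p + (q + 2)) × Fin (q + 1)) (L := FractionRing S)
  have hΦ : IsConstantCoeffAction D Φ := ⟨h1, h2⟩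
  have hg := isCayleySystem_bottomSystem hX hΦ
  have hx := isCayleySystem_X hΦ
  obtain ⟨e1⟩ := nonempty_localCohomology_maximalMinors_equiv X I hI
  obtain ⟨e2⟩ := nonempty_localCohomology_equiv_cechQuotient hg.ne_zero
    (d := (q + 1) * p + q + 2) (by simp; ring) rfl
  obtain ⟨e3⟩ := hg.nonempty_cechQuotient_equiv hΦ hx
  obtain ⟨e4⟩ := nonempty_localCohomology_equiv_cechQuotient hx.ne_zero
    (d := (p + (q + 2)) * (q + 1)) (by simp) h𝔪
  exact ⟨(((e1.trans e2).trans e3).trans e4.symm).toModuleIso⟩
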